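/- arXiv:1708.05462 — 4 statements merged into one kernel-verified Lean document; each statement's English description precedes it below -/
import Mathlib

section
/- Suppose (Enc,Dec) is a (k,n)-coding scheme that is strongly non-malleable with respect to the tampering family F_BIT^{[n],r,w} (with 1 ≤ w ≤ n and r ≤ n) with exact security ε. Then for every set S ⊆ [n] with |S| ≤ r and all messages m0, m1 ∈ {0,1}^k, SD(Enc(m0)_S ; Enc(m1)_S) ≤ ε, where Enc(m)_S denotes the restriction of a sample of Enc(m) to the coordinates in S. (That is, strong non-malleability with respect to F_BIT^{[n],r,w} implies wiretap II indistinguishability security with leakage budget r and security ε.) -/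
/-- Binary words of length `n`. -/
abbrev Word (n : ℕ) := Fin n → Bool

/-- Statistical distance between two distributions on a finite type. -/
noncomputable def SD {Z : Type*} [Fintype Z] (X Y : PMF Z) : ℝ :=
  (1 / 2) * ∑ z, |(X z).toReal - (Y z).toReal|

/-- Restriction of a distribution on words to the coordinates in `S`. -/
noncomputable def restrictPMF {n : ℕ} (S : Finset (Fin n)) (X : PMF (Word n)) :
    PMF ({i : Fin n // i ∈ S} → Bool) :=
  X.map (fun c j => c j.1)

/-- Correctness of a `(k,n)`-coding scheme: decoding a sampled codeword
always returns the message. -/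
def Correct {k n : ℕ} (Enc : Word k → PMF (Word n))
    (Dec : Word n → Option (Word k)) : Prop :=
  ∀ (m : Word k), ∀ c ∈ (Enc m).support, Dec c = some m

/-- The tampering family `F_BIT^{[n],r,w}`: read a set `Sr` of `r` coordinates,
and based on the read values apply bit-tampering functions on a set `Sw`
of `w` coordinates, leaving the others untouched. -/
def FBIT (n r w : ℕ) : Set (Word n → Word n) :=
  { f | ∃ (Sr Sw : Finset (Fin n)), Sr.card = r ∧ Sw.card = w ∧
      ∃ g : ({i : Fin n // i ∈ Sr} → Bool) → ({i : Fin n // i ∈ Sw} → Bool → Bool),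
        ∀ (x : Word n) (i : Fin n),
          f x i = if h : i ∈ Sw then g (fun j => x j.1) ⟨i, h⟩ (x i) else x i }

/-- Outcome alphabet `{0,1}^k ∪ {⊥, same*}`: `Sum.inl m` is a message,
`Sum.inr false` is `⊥`, and `Sum.inr true` is `same*`. -/
abbrev NMOut (k : ℕ) := Word k ⊕ Bool

/-- Patching an outcome with the real message `m`. -/
def patchOut {k : ℕ} (m : Word k) : NMOut k → Option (Word k)
  | Sum.inl m' => some m'
  | Sum.inr true => some m
  | Sum.inr false => none

/-- The distribution of `Dec(f(c))` for `c ← Enc(m)`. -/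
noncomputable def TamperDist {k n : ℕ} (Enc : Word k → PMF (Word n))
    (Dec : Word n → Option (Word k)) (f : Word n → Word n) (m : Word k) :
    PMF (Option (Word k)) :=
  (Enc m).map (fun c => Dec (f c))

/-- `Patch(D, m)`: sample from `D`, replacing `same*` by `m`. -/
noncomputable def PatchDist {k : ℕ} (D : PMF (NMOut k)) (m : Word k) :
    PMF (Option (Word k)) :=
  D.map (patchOut m)

/-- Non-malleability of `(Enc,Dec)` w.r.t. a family `F` with exact security `ε`. -/
def NonMalleable {k n : ℕ} (Enc : Word k → PMF (Word n))
    (Dec : Word n → Option (Word k)) (F : Set (Word n → Word n)) (ε : ℝ) : Prop :=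
  ∀ f ∈ F, ∃ D : PMF (NMOut k), ∀ m : Word k,
    SD (TamperDist Enc Dec f m) (PatchDist D m) ≤ ε

/-- The strong tampering experiment `StrongNM_m^f`. -/
noncomputable def StrongExp {k n : ℕ} (Enc : Word k → PMF (Word n))
    (Dec : Word n → Option (Word k)) (f : Word n → Word n) (m : Word k) :
    PMF (NMOut k) :=
  (Enc m).map (fun c =>
    if f c = c then (Sum.inr true : NMOut k)
    else
      match Dec (f c) with
      | some m' => Sum.inl m'
      | none => Sum.inr false)

/-- Strong non-malleability with exact security `ε`. -/
def StronglyNonMalleable {k n : ℕ} (Enc : Word k → PMF (Word n))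
    (Dec : Word n → Option (Word k)) (F : Set (Word n → Word n)) (ε : ℝ) : Prop :=
  ∀ f ∈ F, ∀ m0 m1 : Word k,
    SD (StrongExp Enc Dec f m0) (StrongExp Enc Dec f m1) ≤ ε

theorem PMF.sum_toReal {Z : Type*} [Fintype Z] (X : PMF Z) : ∑ z, (X z).toReal = 1 := by
  rw [← ENNReal.toReal_sum fun z _ => X.apply_ne_top z, ← tsum_fintype (L := .unconditional _), X.tsum_coe,
    ENNReal.toReal_one]

open Classical in
theorem PMF.map_apply_toReal {Y Z : Type*} [Fintype Y] (X : PMF Y) (φ : Y → Z) (z : Z) :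
    (X.map φ z).toReal = ∑ y, if φ y = z then (X y).toReal else 0 := by
  rw [PMF.map_apply, tsum_fintype, ENNReal.toReal_sum]
  · refine Finset.sum_congr rfl fun y _ => ?_
    by_cases h : φ y = z
    · simp [h]
    · simp [h, Ne.symm h]
  · intro y _
    split_ifs
    · exact X.apply_ne_top y
    · exact ENNReal.zero_ne_top

theorem SD_eq_sum_filter {Z : Type*} [Fintype Z] (X Y : PMF Z) :
    SD X Y = ∑ z with (Y z).toReal ≤ (X z).toReal, ((X z).toReal - (Y z).toReal) := by
  have h : ∑ z, ((X z).toReal - (Y z).toReal) = 0 := by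
    rw [Finset.sum_sub_distrib, X.sum_toReal, Y.sum_toReal, sub_self]
  calc SD X Y
      = (1 / 2) * (∑ z, |(X z).toReal - (Y z).toReal|
          + ∑ z, ((X z).toReal - (Y z).toReal)) := by rw [h, add_zero, SD]
    _ = _ := by
      rw [← Finset.sum_add_distrib, Finset.mul_sum, Finset.sum_filter]
      refine Finset.sum_congr rfl fun z _ => ?_
      split_ifs with hz
      · rw [abs_of_nonneg (sub_nonneg.2 hz)]; ring
      · rw [abs_of_neg (sub_neg.2 (not_le.1 hz))]; ring

theorem sub_le_SD {Z : Type*} [Fintype Z] (X Y : PMF Z) (z : Z) :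
    (X z).toReal - (Y z).toReal ≤ SD X Y := by
  rw [SD_eq_sum_filter]
  by_cases hz : (Y z).toReal ≤ (X z).toReal
  · refine Finset.single_le_sum (f := fun z => (X z).toReal - (Y z).toReal)
      (fun y hy => sub_nonneg.2 (Finset.mem_filter.1 hy).2) ?_
    simpa using hz
  · exact (sub_nonpos.2 (not_le.1 hz).le).trans
      (Finset.sum_nonneg fun y hy => sub_nonneg.2 (Finset.mem_filter.1 hy).2)

/-- The tampering function that leaves `x` untouched if its restriction to `S` lies in `A`, and
flips the bits of `x` in `Sw` otherwise. -/
def flipUnless {n : ℕ} (S Sw : Finset (Fin n)) (A : Finset ({i : Fin n // i ∈ S} → Bool))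
    (x : Word n) : Word n :=
  fun i => if i ∈ Sw ∧ (fun j => x j.1) ∉ A then !(x i) else x i

theorem flipUnless_mem_FBIT {n : ℕ} {S Sr Sw : Finset (Fin n)} (hS : S ⊆ Sr)
    (A : Finset ({i : Fin n // i ∈ S} → Bool)) :
    flipUnless S Sw A ∈ FBIT n Sr.card Sw.card := by
  refine ⟨Sr, Sw, rfl, rfl,
    fun α _ b => if (fun j : {i // i ∈ S} => α ⟨j.1, hS j.2⟩) ∉ A then !b else b,
    fun x i => ?_⟩
  by_cases hi : i ∈ Sw <;> simp [flipUnless, hi]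

theorem flipUnless_eq_self_iff {n : ℕ} {S Sw : Finset (Fin n)} (hSw : Sw.Nonempty)
    (A : Finset ({i : Fin n // i ∈ S} → Bool)) (x : Word n) :
    flipUnless S Sw A x = x ↔ (fun j => x j.1) ∈ A := by
  constructor
  · intro h
    obtain ⟨i, hi⟩ := hSw
    by_contra hA
    simpa [flipUnless, hi, hA] using congrFun h i
  · intro h
    funext i
    simp [flipUnless, h]

theorem StrongExp_same_toReal {k n : ℕ} (Enc : Word k → PMF (Word n))
    (Dec : Word n → Option (Word k)) (f : Word n → Word n) (m : Word k) :
    (StrongExp Enc Dec f m (Sum.inr true)).toReal =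
      ∑ c, if f c = c then (Enc m c).toReal else 0 := by
  rw [StrongExp, PMF.map_apply_toReal]
  refine Finset.sum_congr rfl fun c _ => ?_
  by_cases h : f c = c
  · simp [h]
  · cases hd : Dec (f c) <;> simp [h]

theorem sum_restrictPMF_toReal {n : ℕ} (S : Finset (Fin n)) (X : PMF (Word n))
    (A : Finset ({i : Fin n // i ∈ S} → Bool)) :
    ∑ z ∈ A, (restrictPMF S X z).toReal =
      ∑ c, if (fun j : {i // i ∈ S} => c j.1) ∈ A then (X c).toReal else 0 := by
  simp_rw [restrictPMF, PMF.map_apply_toReal]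
  rw [Finset.sum_comm]
  refine Finset.sum_congr rfl fun c _ => ?_
  rw [← Finset.sum_ite_eq A (fun j : {i // i ∈ S} => c j.1) (fun _ => (X c).toReal)]
  refine Finset.sum_congr rfl fun z _ => ?_
  congr

/-- Strong non-malleability with respect to `F_BIT^{[n],r,w]}` implies
wiretap II indistinguishability security with leakage budget `r` and security `ε`. -/
theorem strongNM_implies_wiretap_secrecy
    (k n r w : ℕ) (hw1 : 1 ≤ w) (hwn : w ≤ n) (hrn : r ≤ n)
    (Enc : Word k → PMF (Word n)) (Dec : Word n → Option (Word k)) (ε : ℝ)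
    (hcorrect : Correct Enc Dec)
    (hSNM : StronglyNonMalleable Enc Dec (FBIT n r w) ε) :
    ∀ S : Finset (Fin n), S.card ≤ r → ∀ m0 m1 : Word k,
      SD (restrictPMF S (Enc m0)) (restrictPMF S (Enc m1)) ≤ ε := by
  intro S hS m0 m1
  obtain ⟨Sr, hSr, rfl⟩ := Finset.exists_superset_card_eq hS (by simpa using hrn)
  obtain ⟨Sw, -, rfl⟩ := Finset.exists_subset_card_eq
    (s := (Finset.univ : Finset (Fin n))) (n := w) (by simpa using hwn)
  have hne : Sw.Nonempty := Finset.card_pos.1 hw1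
  rw [SD_eq_sum_filter, Finset.sum_sub_distrib, sum_restrictPMF_toReal, sum_restrictPMF_toReal]
  set A := Finset.univ.filter fun z =>
    (restrictPMF S (Enc m1) z).toReal ≤ (restrictPMF S (Enc m0) z).toReal
  have h := (sub_le_SD _ _ (Sum.inr true)).trans
    (hSNM _ (flipUnless_mem_FBIT (Sw := Sw) hSr A) m0 m1)
  simpa only [StrongExp_same_toReal, flipUnless_eq_self_iff hne] using h
end

section
/- Fix constants ρ_r, ρ_w ∈ (0,1] and ξ ∈ (0,1) with ρ_r + ξ < 1. Then there exist a constant c > 0 and an integer n0 such that for every n ≥ n0 there exists a (k,n)-coding scheme with k ≥ n(1 − ρ_r − ξ) that is strongly non-malleable with respect to the tampering family F_BIT^{[n],⌊nρ_r⌋,⌊nρ_w⌋} with exact security 2^{−cn}. (Hence the achievable rate of strongly non-malleable codes for this family is at least 1 − ρ_r.) -/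
open Finset

/-! ### Counting functions with prescribed statistics -/

section Concentration

variable {I L : Type*} [Fintype I] [DecidableEq I] [Fintype L] [DecidableEq L]

/-- The number of points of `V` that `D` labels by an element of `P`. -/
def labelCount (V : Finset I) (P : Finset L) (D : I → L) : ℕ :=
  #{c ∈ V | D c ∈ P}

theorem sum_exp_labelCount_le [Nonempty L] (V : Finset I) (P : Finset L) (σ : ℝ) :
    ∑ D : I → L, Real.exp (σ * labelCount V P D) ≤
      Fintype.card (I → L) *
        Real.exp ((#V : ℝ) * #P / Fintype.card L * (Real.exp σ - 1)) := by
  set l : ℝ := ((Fintype.card L : ℕ) : ℝ) with hl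
  have hl0 : 0 < l := by simp [hl, Fintype.card_pos]
  have hprod (D : I → L) : Real.exp (σ * labelCount V P D) =
      ∏ c, (if c ∈ V ∧ D c ∈ P then Real.exp σ else 1) := by
    rw [Finset.prod_ite]
    have : ({c | c ∈ V ∧ D c ∈ P} : Finset I) = {c ∈ V | D c ∈ P} := by ext; simp
    simp [this, labelCount, ← Real.exp_nat_mul, mul_comm]
  have hfac (c : I) : ∑ x : L, (if c ∈ V ∧ x ∈ P then Real.exp σ else 1) =
      l * (if c ∈ V then 1 + #P / l * (Real.exp σ - 1) else 1) := by
    by_cases hc : c ∈ V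
    · have : ∀ x : L, (if x ∈ P then Real.exp σ else 1) =
          1 + (if x ∈ P then Real.exp σ - 1 else 0) := by
        intro x; split_ifs <;> ring
      simp only [hc, true_and, if_true, this, Finset.sum_add_distrib]
      simp [← hl]
      field_simp
    · simp [hc, hl]
  calc ∑ D : I → L, Real.exp (σ * labelCount V P D)
      = ∏ c : I, ∑ x : L, (if c ∈ V ∧ x ∈ P then Real.exp σ else 1) := by
        simp_rw [hprod]
        rw [Finset.prod_univ_sum, Fintype.piFinset_univ]
    _ = (l : ℝ) ^ Fintype.card I * (1 + #P / l * (Real.exp σ - 1)) ^ #V := by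
        simp_rw [hfac, Finset.prod_mul_distrib, Finset.prod_ite]
        simp
    _ ≤ l ^ Fintype.card I * (Real.exp (#P / l * (Real.exp σ - 1))) ^ #V := by
        have h0 : 0 ≤ 1 + #P / l * (Real.exp σ - 1) := by
          have h1 : (#P : ℝ) / l ≤ 1 := by
            rw [div_le_one hl0, hl]; exact_mod_cast Finset.card_le_univ P
          have h2 : 0 ≤ (#P : ℝ) / l := by positivity
          nlinarith [Real.exp_pos σ]
        gcongr
        linarith [Real.add_one_le_exp (#P / l * (Real.exp σ - 1))]
    _ = _ := by
        rw [← Real.exp_nat_mul, Fintype.card_fun]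
        push_cast
        rw [← hl]
        congr 2
        ring

theorem card_exp_tail_le [Nonempty L] (V : Finset I) (P : Finset L) {μ' a σ : ℝ}
    (hμ : (#V : ℝ) * #P / Fintype.card L ≤ μ') (hσ : |σ| ≤ 1) :
    (#{D : I → L | a ≤ σ * (labelCount V P D - (#V : ℝ) * #P / Fintype.card L)} : ℝ) ≤
      Real.exp (σ ^ 2 * μ' - a) * Fintype.card (I → L) := by
  set μ : ℝ := (#V : ℝ) * #P / Fintype.card L with hμdef
  have hμ0 : 0 ≤ μ := by positivity
  have h1 : (#{D : I → L | a ≤ σ * (labelCount V P D - μ)} : ℝ) * Real.exp a ≤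
      ∑ D : I → L, Real.exp (σ * (labelCount V P D - μ)) := by
    rw [← nsmul_eq_mul, ← Finset.sum_const]
    refine (Finset.sum_le_sum fun D hD => ?_).trans
      (Finset.sum_le_sum_of_subset_of_nonneg (Finset.subset_univ _)
        fun _ _ _ => (Real.exp_pos _).le)
    exact Real.exp_le_exp.2 (Finset.mem_filter.1 hD).2
  have h2 : ∑ D : I → L, Real.exp (σ * (labelCount V P D - μ)) ≤
      Fintype.card (I → L) * Real.exp (σ ^ 2 * μ') := by
    have : ∀ D : I → L, Real.exp (σ * (labelCount V P D - μ)) =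
        Real.exp (σ * labelCount V P D) * Real.exp (-(σ * μ)) := by
      intro D; rw [← Real.exp_add]; ring_nf
    simp_rw [this]
    rw [← Finset.sum_mul]
    refine (mul_le_mul_of_nonneg_right (sum_exp_labelCount_le V P σ)
      (Real.exp_pos _).le).trans ?_
    rw [mul_assoc, ← Real.exp_add, ← hμdef]
    gcongr
    have h3 := le_abs_self _ |>.trans (Real.abs_exp_sub_one_sub_id_le hσ)
    nlinarith [sq_nonneg σ]
  rw [sub_eq_add_neg, Real.exp_add, Real.exp_neg]
  have := h1.trans h2
  rw [← le_div_iff₀ (Real.exp_pos a)] at this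
  refine this.trans (le_of_eq ?_)
  field_simp

/-- Chernoff bound for the number of points of `V` with label in `P`. -/
theorem card_labelCount_deviation_le [Nonempty L] (V : Finset I) (P : Finset L) {μ' t : ℝ}
    (hμ : (#V : ℝ) * #P / Fintype.card L ≤ μ') (ht0 : 0 ≤ t) (ht1 : t ≤ 1) :
    (#{D : I → L | 2 * t * μ' ≤ |labelCount V P D - (#V : ℝ) * #P / Fintype.card L|} : ℝ) ≤
      2 * Real.exp (-(t ^ 2 * μ')) * Fintype.card (I → L) := by
  classical
  have hup := card_exp_tail_le V P (a := 2 * t ^ 2 * μ') (σ := t) hμ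
    (by rwa [abs_of_nonneg ht0])
  have hlo := card_exp_tail_le V P (a := 2 * t ^ 2 * μ') (σ := -t) hμ
    (by rwa [abs_neg, abs_of_nonneg ht0])
  set μ : ℝ := (#V : ℝ) * #P / Fintype.card L
  have hsub : ({D : I → L | 2 * t * μ' ≤ |labelCount V P D - μ|} : Finset (I → L)) ⊆
      ({D : I → L | 2 * t ^ 2 * μ' ≤ t * (labelCount V P D - μ)} : Finset (I → L)) ∪
      ({D : I → L | 2 * t ^ 2 * μ' ≤ -t * (labelCount V P D - μ)} : Finset (I → L)) := by
    intro D hD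
    simp only [Finset.mem_union, Finset.mem_filter, Finset.mem_univ, true_and] at hD ⊢
    rcases le_abs.1 hD with h | h
    · left; nlinarith
    · right; nlinarith
  have hcard := (Finset.card_le_card hsub).trans (Finset.card_union_le _ _)
  have hcard' : (#{D : I → L | 2 * t * μ' ≤ |labelCount V P D - μ|} : ℝ) ≤ _ :=
    (Nat.cast_le (α := ℝ)).2 hcard
  push_cast at hcard'
  have e1 : t ^ 2 * μ' - 2 * t ^ 2 * μ' = -(t ^ 2 * μ') := by ring
  have e2 : (-t) ^ 2 * μ' - 2 * t ^ 2 * μ' = -(t ^ 2 * μ') := by ring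
  rw [e1] at hup
  rw [e2] at hlo
  linarith

end Concentration

/-- Resampling the values of a function outside `H` does not change the uniform distribution. -/
theorem card_filter_le_of_forall_piecewise {I L : Type*} [Fintype I] [DecidableEq I]
    [Fintype L] [Nonempty L] (H : I → Prop) [DecidablePred H]
    (Q : (I → L) → Prop) [DecidablePred Q] {B : ℝ}
    (hB : ∀ D' : I → L,
      (#{D : I → L | Q (fun c => if H c then D c else D' c)} : ℝ) ≤ B) :
    (#{D : I → L | Q D} : ℝ) ≤ B := by
  let e : (I → L) × (I → L) ≃ (I → L) × (I → L) :=
    { toFun := fun p => (fun c => if H c then p.1 c else p.2 c,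
        fun c => if H c then p.2 c else p.1 c)
      invFun := fun p => (fun c => if H c then p.1 c else p.2 c,
        fun c => if H c then p.2 c else p.1 c)
      left_inv := fun p => by ext c <;> simp only <;> split_ifs <;> rfl
      right_inv := fun p => by ext c <;> simp only <;> split_ifs <;> rfl }
  have h1 : (∑ p : (I → L) × (I → L), if Q (e p).1 then (1 : ℝ) else 0) =
      ∑ p : (I → L) × (I → L), if Q p.1 then (1 : ℝ) else 0 :=
    e.sum_comp fun p => if Q p.1 then (1 : ℝ) else 0
  rw [Fintype.sum_prod_type_right, Fintype.sum_prod_type_right] at h1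
  simp only [Finset.sum_boole, Finset.sum_const, Finset.card_univ, nsmul_eq_mul] at h1
  have h2 := Finset.sum_le_sum fun (D' : I → L) (_ : D' ∈ Finset.univ) => hB D'
  have h3 : (0 : ℝ) < Fintype.card (I → L) := by exact_mod_cast Fintype.card_pos
  simp only [Finset.sum_const, Finset.card_univ, nsmul_eq_mul] at h2
  exact le_of_mul_le_mul_left (h1.symm.le.trans h2) h3

theorem card_filter_exists_le {Ω J : Type*} [Fintype Ω] [Fintype J] (Q : J → Ω → Prop)
    [∀ j, DecidablePred (Q j)] [DecidablePred fun D => ∃ j, Q j D] {B : ℝ}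
    (hB : ∀ j, (#{D | Q j D} : ℝ) ≤ B) :
    (#{D | ∃ j, Q j D} : ℝ) ≤ Fintype.card J * B := by
  classical
  have hsub : ({D | ∃ j, Q j D} : Finset Ω) ⊆ Finset.univ.biUnion fun j => {D | Q j D} := by
    intro D; simp
  have h1 := (Finset.card_le_card hsub).trans Finset.card_biUnion_le
  calc (#{D | ∃ j, Q j D} : ℝ) ≤ ∑ j, (#{D | Q j D} : ℝ) := by exact_mod_cast h1
    _ ≤ ∑ _j : J, B := Finset.sum_le_sum fun j _ => hB j
    _ = _ := by simp

/-! ### Subcubes and bitwise maps -/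

/-- The subcube of words that agree with `β` on `A`. -/
def cube {n : ℕ} (A : Finset (Fin n)) (β : Word n) : Finset (Word n) :=
  {c | ∀ i ∈ A, c i = β i}

theorem mem_cube {n : ℕ} {A : Finset (Fin n)} {β c : Word n} :
    c ∈ cube A β ↔ ∀ i ∈ A, c i = β i := by simp [cube]

theorem card_cube {n : ℕ} (A : Finset (Fin n)) (β : Word n) :
    #(cube A β) = 2 ^ (n - #A) := by
  have : cube A β = Fintype.piFinset fun i => if i ∈ A then {β i} else Finset.univ := by
    ext c
    simp only [mem_cube, Fintype.mem_piFinset]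
    refine forall_congr' fun i => ?_
    by_cases hi : i ∈ A <;> simp [hi]
  rw [this, Fintype.card_piFinset]
  have h2 (i : Fin n) : #(if i ∈ A then {β i} else (Finset.univ : Finset Bool)) =
      if i ∈ A then 1 else 2 := by split_ifs <;> simp
  simp_rw [h2, Finset.prod_ite]
  simp [Finset.filter_not, Finset.card_sdiff]

theorem cast_card_cube {n : ℕ} (A : Finset (Fin n)) (β : Word n) :
    (#(cube A β) : ℝ) = 2 ^ n / 2 ^ #A := by
  rw [card_cube, Nat.cast_pow, Nat.cast_ofNat, pow_sub₀ _ two_ne_zero (by simpa using card_le_univ A)]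
  rfl

/-- The coordinatewise map with components `h i`. -/
def bitwise {n : ℕ} (h : Fin n → Bool → Bool) (c : Word n) : Word n := fun i => h i (c i)

/-- The coordinates outside `S` at which `h` is not constant. -/
def freeCoords {n : ℕ} (S : Finset (Fin n)) (h : Fin n → Bool → Bool) : Finset (Fin n) :=
  {i | i ∉ S ∧ h i true ≠ h i false}

theorem disjoint_freeCoords {n : ℕ} (S : Finset (Fin n)) (h : Fin n → Bool → Bool) :
    Disjoint S (freeCoords S h) := by
  rw [Finset.disjoint_left]
  intro i hi hi'
  simp [freeCoords, hi] at hi'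

theorem eq_of_mem_freeCoords {n : ℕ} {S : Finset (Fin n)} {h : Fin n → Bool → Bool} {i : Fin n}
    (hi : i ∈ freeCoords S h) {x y : Bool} (hxy : h i x = h i y) : x = y := by
  have := (Finset.mem_filter.1 hi).2.2
  cases x <;> cases y <;> simp_all

theorem bitwise_eq_of_notMem_freeCoords {n : ℕ} {S : Finset (Fin n)} {h : Fin n → Bool → Bool}
    {i : Fin n} (hi : i ∉ freeCoords S h) {x y : Bool} (hxy : i ∈ S → x = y) :
    h i x = h i y := by
  by_cases hS : i ∈ S
  · rw [hxy hS]
  · have : h i true = h i false := by simpa [freeCoords, hS] using hi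
    cases x <;> cases y <;> simp_all

theorem bitwise_mem_cube {n : ℕ} {S : Finset (Fin n)} {h : Fin n → Bool → Bool} {α c : Word n}
    (hc : c ∈ cube S α) : bitwise h c ∈ cube (freeCoords S h)ᶜ (bitwise h α) :=
  mem_cube.2 fun _ hi =>
    bitwise_eq_of_notMem_freeCoords (Finset.mem_compl.1 hi) fun hS => mem_cube.1 hc _ hS

theorem card_filter_bitwise_eq_le {n : ℕ} (S : Finset (Fin n)) (h : Fin n → Bool → Bool)
    (α y : Word n) :
    #{c ∈ cube S α | bitwise h c = y} ≤ 2 ^ (n - (#S + #(freeCoords S h))) := by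
  rcases Finset.eq_empty_or_nonempty {c ∈ cube S α | bitwise h c = y} with he | ⟨c₀, hc₀⟩
  · simp [he]
  · rw [← Finset.card_union_of_disjoint (disjoint_freeCoords S h), ← card_cube _ c₀]
    refine Finset.card_le_card fun c hc => mem_cube.2 fun i hi => ?_
    rw [Finset.mem_filter] at hc hc₀
    rcases Finset.mem_union.1 hi with hi | hi
    · rw [mem_cube.1 hc.1 i hi, mem_cube.1 hc₀.1 i hi]
    · exact eq_of_mem_freeCoords hi (congrFun (hc.2.trans hc₀.2.symm) i)

/-! ### Balanced labellings -/

/-- A label consists of a message and a tag; it is valid if the tag vanishes. -/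
abbrev TaggedWord (k q : ℕ) := Word k × Word q

/-- The tagged words with vanishing tag. -/
def validLabels (k q : ℕ) : Finset (TaggedWord k q) := {l | l.2 = fun _ => false}

theorem mem_validLabels {k q : ℕ} {l : TaggedWord k q} :
    l ∈ validLabels k q ↔ l.2 = fun _ => false := by simp [validLabels]

theorem card_validLabels (k q : ℕ) : #(validLabels k q) = 2 ^ k := by
  have : validLabels k q = Finset.univ ×ˢ {fun _ => false} := by
    ext ⟨a, b⟩; simp [mem_validLabels, eq_comm]
  rw [this]; simp

theorem card_taggedWord (k q : ℕ) : Fintype.card (TaggedWord k q) = 2 ^ (k + q) := by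
  simp [pow_add]

/-- The words in a subcube with label `l` which `h` maps to a different, validly labelled word. -/
def escapes {n k q : ℕ} (D : Word n → TaggedWord k q) (S : Finset (Fin n)) (α : Word n)
    (h : Fin n → Bool → Bool) (l : TaggedWord k q) : Finset (Word n) :=
  {c ∈ cube S α | bitwise h c ≠ c ∧ D c = l ∧ D (bitwise h c) ∈ validLabels k q}

/-- The part of `escapes` on which `h` changes coordinate `i` from `b` to `!b`. -/
def escapesAt {n k q : ℕ} (D : Word n → TaggedWord k q) (S : Finset (Fin n)) (α : Word n)
    (h : Fin n → Bool → Bool) (i : Fin n) (b : Bool) (l : TaggedWord k q) : Finset (Word n) :=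
  {c ∈ cube S α | (c i = b ∧ h i (c i) = !b) ∧ D c = l ∧ D (bitwise h c) ∈ validLabels k q}

theorem escapes_subset {n k q : ℕ} (D : Word n → TaggedWord k q) (S : Finset (Fin n))
    (α : Word n) (h : Fin n → Bool → Bool) (l : TaggedWord k q) :
    escapes D S α h l ⊆
      Finset.univ.biUnion fun p : Fin n × Bool => escapesAt D S α h p.1 p.2 l := by
  intro c hc
  obtain ⟨hS, hne, hl, hv⟩ := Finset.mem_filter.1 hc
  obtain ⟨i, hi⟩ := Function.ne_iff.1 hne
  refine Finset.mem_biUnion.2 ⟨(i, c i), Finset.mem_univ _, Finset.mem_filter.2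
    ⟨hS, ⟨rfl, ?_⟩, hl, hv⟩⟩
  simp only [bitwise] at hi
  cases hci : c i <;> simp_all

/-- The label statistics needed from a good labelling: every label is equidistributed on every
subcube of codimension at least `r`, and few words escape to other validly labelled words. -/
structure IsBalanced {n k : ℕ} (r d : ℕ) (D : Word n → TaggedWord k (2 * d)) : Prop where
  cube_count : ∀ (A : Finset (Fin n)) (β : Word n) (l : TaggedWord k (2 * d)), r ≤ #A →
    |(#{c ∈ cube A β | D c = l} : ℝ) - 2 ^ n / 2 ^ #A / 2 ^ (k + 2 * d)| ≤
      2 ^ n / 2 ^ r / 2 ^ (k + 2 * d) / 8 ^ d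
  escape_count : ∀ (S : Finset (Fin n)) (α : Word n) (h : Fin n → Bool → Bool)
    (l : TaggedWord k (2 * d)), #S = r → 2 * d ≤ #(freeCoords S h) →
    (#(escapes D S α h l) : ℝ) ≤ 18 * n * (2 ^ n / 2 ^ r / 2 ^ (k + 2 * d) / 2 ^ d)

theorem two_pow_le_average {n k r d : ℕ} (hn : k + r + 12 * d ≤ n) :
    (2 : ℝ) ^ (10 * d) ≤ 2 ^ n / 2 ^ r / 2 ^ (k + 2 * d) := by
  rw [le_div_iff₀ (by positivity), le_div_iff₀ (by positivity), ← pow_add, ← pow_add]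
  exact pow_le_pow_right₀ one_le_two (by omega)

theorem card_cube_deviation_le {n k r d : ℕ} (hn : k + r + 12 * d ≤ n) (hd : 1 ≤ d)
    (A : Finset (Fin n)) (β : Word n) (l : TaggedWord k (2 * d)) (hA : r ≤ #A) :
    (#{D : Word n → TaggedWord k (2 * d) | 2 ^ n / 2 ^ r / 2 ^ (k + 2 * d) / 8 ^ d <
      |(#{c ∈ cube A β | D c = l} : ℝ) - 2 ^ n / 2 ^ #A / 2 ^ (k + 2 * d)|} : ℝ) ≤
      2 * Real.exp (-(2 ^ d)) * Fintype.card (Word n → TaggedWord k (2 * d)) := by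
  set τ : ℝ := 2 ^ n / 2 ^ r / 2 ^ (k + 2 * d) with hτ
  have hμ : (#(cube A β) : ℝ) * #{l} / Fintype.card (TaggedWord k (2 * d)) =
      2 ^ n / 2 ^ #A / 2 ^ (k + 2 * d) := by
    rw [cast_card_cube, card_taggedWord]; simp
  have hle : (2 : ℝ) ^ n / 2 ^ #A / 2 ^ (k + 2 * d) ≤ τ := by
    rw [hτ]; gcongr; exact one_le_two
  have h8 : (1 : ℝ) ≤ 8 ^ d := one_le_pow₀ (by norm_num)
  have key := card_labelCount_deviation_le (cube A β) {l} (t := 1 / (2 * 8 ^ d))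
    (hμ.trans_le hle) (by positivity) (by rw [div_le_one (by positivity)]; linarith)
  rw [hμ] at key
  refine le_trans (Nat.cast_le (α := ℝ).2 (Finset.card_le_card fun D hD => ?_)) (key.trans ?_)
  · simp only [Finset.mem_filter, Finset.mem_univ, true_and, labelCount,
      Finset.mem_singleton] at hD ⊢
    refine le_trans (le_of_eq ?_) hD.le
    field_simp
  · gcongr
    have h1 := two_pow_le_average hn
    rw [← hτ] at h1
    have h2 : (2 : ℝ) ^ (10 * d) = 8 ^ d * 8 ^ d * 8 ^ d * 2 ^ d := by
      rw [← mul_pow, ← mul_pow, ← mul_pow, pow_mul]; norm_num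
    have h3 : (8 : ℝ) ≤ 8 ^ d := le_self_pow₀ (by norm_num) (by omega)
    rw [div_pow, one_pow, one_div, inv_mul_eq_div, le_div_iff₀ (by positivity)]
    have h4 : (0 : ℝ) < 2 ^ d := by positivity
    have h5 : (0 : ℝ) < 2 ^ d * (8 ^ d) ^ 2 := by positivity
    nlinarith

theorem card_valid_deviation_le {n k d : ℕ} (A : Finset (Fin n)) (β : Word n)
    (hA : #A + 2 * d ≤ n) :
    (#{D : Word n → TaggedWord k (2 * d) | 3 * (2 ^ n / 2 ^ #A / 2 ^ d : ℝ) <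
      #{c ∈ cube A β | D c ∈ validLabels k (2 * d)}} : ℝ) ≤
      2 * Real.exp (-(2 ^ d)) * Fintype.card (Word n → TaggedWord k (2 * d)) := by
  have hμ : (#(cube A β) : ℝ) * #(validLabels k (2 * d)) /
      Fintype.card (TaggedWord k (2 * d)) ≤ 2 ^ n / 2 ^ #A / 2 ^ d := by
    rw [cast_card_cube, card_taggedWord, card_validLabels]
    push_cast
    rw [pow_add, two_mul, pow_add]
    have h1 : (1 : ℝ) ≤ 2 ^ d := one_le_pow₀ one_le_two
    have h2 : (2 : ℝ) ^ n / 2 ^ #A * 2 ^ k / (2 ^ k * (2 ^ d * 2 ^ d)) =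
      2 ^ n / 2 ^ #A / 2 ^ d / 2 ^ d := by field_simp
    rw [h2]
    exact div_le_self (by positivity) h1
  have key := card_labelCount_deviation_le (cube A β) (validLabels k (2 * d)) (t := 1) hμ
    zero_le_one le_rfl
  refine le_trans (Nat.cast_le (α := ℝ).2 (Finset.card_le_card fun D hD => ?_)) (key.trans ?_)
  · rw [Finset.mem_filter] at hD ⊢
    refine ⟨Finset.mem_univ _, le_abs.2 (Or.inl ?_)⟩
    have hD' := hD.2
    rw [labelCount]
    linarith
  · gcongr
    rw [one_pow, one_mul, le_div_iff₀ (by positivity), le_div_iff₀ (by positivity), ← pow_add,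
      ← pow_add]
    exact pow_le_pow_right₀ one_le_two (by omega)

theorem card_escape_deviation_le {n k r d : ℕ} (hn : k + r + 12 * d ≤ n) (S : Finset (Fin n))
    (α : Word n) (h : Fin n → Bool → Bool) (i : Fin n) (b : Bool) (l : TaggedWord k (2 * d))
    (hS : #S = r) :
    (#{D : Word n → TaggedWord k (2 * d) |
      (#{y ∈ cube (freeCoords S h)ᶜ (bitwise h α) | D y ∈ validLabels k (2 * d)} : ℝ) ≤
        3 * (2 ^ n / 2 ^ #(freeCoords S h)ᶜ / 2 ^ d) ∧
      9 * (2 ^ n / 2 ^ r / 2 ^ (k + 2 * d) / 2 ^ d : ℝ) < #(escapesAt D S α h i b l)} : ℝ) ≤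
      2 * Real.exp (-(2 ^ d)) * Fintype.card (Word n → TaggedWord k (2 * d)) := by
  refine card_filter_le_of_forall_piecewise (fun c : Word n => c i = b) _ fun D' => ?_
  set W : Finset (Word n) :=
    {c ∈ cube S α | (c i = b ∧ h i (c i) = !b) ∧ D' (bitwise h c) ∈ validLabels k (2 * d)}
    with hW
  set u := #(freeCoords S h) with hu
  have hru : r + u ≤ n := by
    rw [← hS, hu, ← Finset.card_union_of_disjoint (disjoint_freeCoords S h)]
    simpa using card_le_univ (S ∪ freeCoords S h)
  have hUc : #(freeCoords S h)ᶜ = n - u := by simp [Finset.card_compl, hu]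
  have hmix (D : Word n → TaggedWord k (2 * d)) {c : Word n} (hc : h i (c i) = !b) :
      (if bitwise h c i = b then D (bitwise h c) else D' (bitwise h c)) = D' (bitwise h c) := by
    simp [bitwise, hc]
  by_cases hcard : (#W : ℝ) ≤ 3 * (2 ^ n / 2 ^ r / 2 ^ d)
  · have hμ : (#W : ℝ) * #{l} / Fintype.card (TaggedWord k (2 * d)) ≤
        3 * (2 ^ n / 2 ^ r / 2 ^ (k + 2 * d) / 2 ^ d) := by
      rw [card_taggedWord, Finset.card_singleton]
      push_cast
      rw [mul_one, div_le_iff₀ (by positivity)]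
      refine hcard.trans (le_of_eq ?_)
      field_simp
    have key := card_labelCount_deviation_le W {l} (t := 1) hμ zero_le_one le_rfl
    refine le_trans (Nat.cast_le (α := ℝ).2 (Finset.card_le_card fun D hD => ?_)) (key.trans ?_)
    · simp only [Finset.mem_filter, Finset.mem_univ, true_and] at hD ⊢
      have hX : escapesAt (fun c => if c i = b then D c else D' c) S α h i b l =
          {c ∈ W | D c ∈ ({l} : Finset _)} := by
        ext c
        simp only [escapesAt, hW, Finset.mem_filter, Finset.mem_singleton]
        constructor
        · rintro ⟨h1, ⟨h2, h3⟩, h4, h5⟩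
          rw [hmix D h3] at h5
          exact ⟨⟨h1, ⟨h2, h3⟩, h5⟩, by rwa [if_pos h2] at h4⟩
        · rintro ⟨⟨h1, ⟨h2, h3⟩, h5⟩, h4⟩
          refine ⟨h1, ⟨h2, h3⟩, by rwa [if_pos h2], ?_⟩
          rwa [hmix D h3]
      rw [hX] at hD
      refine le_trans ?_ (le_abs_self _)
      rw [labelCount]
      linarith [hD.2]
    · gcongr
      have h1 := two_pow_le_average hn
      have h2 : (2 : ℝ) ^ (d + d) ≤ 2 ^ (10 * d) := pow_le_pow_right₀ one_le_two (by omega)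
      rw [one_pow, one_mul]
      rw [pow_add] at h2
      have h3 : (2 : ℝ) ^ d ≤ 2 ^ n / 2 ^ r / 2 ^ (k + 2 * d) / 2 ^ d := by
        rw [le_div_iff₀ (by positivity)]; exact h2.trans h1
      have h4 : (0 : ℝ) < 2 ^ d := by positivity
      linarith
  · rw [Finset.filter_false_of_mem]
    · rw [Finset.card_empty, Nat.cast_zero]; positivity
    rintro D - ⟨hD, -⟩
    refine hcard ?_
    have h1 : #W ≤ 2 ^ (n - (r + u)) * #(W.image (bitwise h)) := by
      refine Finset.card_le_mul_card_image W _ fun y _ => ?_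
      rw [← hS]
      refine le_trans (Finset.card_le_card ?_) (card_filter_bitwise_eq_le S h α y)
      exact Finset.filter_subset_filter _ (Finset.filter_subset _ _)
    have h2 : #(W.image (bitwise h)) ≤ #{y ∈ cube (freeCoords S h)ᶜ (bitwise h α) |
        (if y i = b then D y else D' y) ∈ validLabels k (2 * d)} := by
      refine Finset.card_le_card fun y hy => ?_
      obtain ⟨c, hc, rfl⟩ := Finset.mem_image.1 hy
      obtain ⟨hcS, ⟨-, h3⟩, h5⟩ := Finset.mem_filter.1 hc
      refine Finset.mem_filter.2 ⟨bitwise_mem_cube hcS, ?_⟩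
      rwa [hmix D h3]
    have h3 : (#W : ℝ) ≤ 2 ^ (n - (r + u)) * #(W.image (bitwise h)) := by exact_mod_cast h1
    have h4 : (#(W.image (bitwise h)) : ℝ) ≤ 3 * (2 ^ n / 2 ^ #(freeCoords S h)ᶜ / 2 ^ d) :=
      (Nat.cast_le (α := ℝ).2 h2).trans hD
    refine (h3.trans (mul_le_mul_of_nonneg_left h4 (by positivity))).trans (le_of_eq ?_)
    rw [hUc, pow_sub₀ _ two_ne_zero hru, pow_sub₀ _ two_ne_zero (by omega), pow_add]
    field_simp

theorem exists_isBalanced {n k r d : ℕ} (hn : k + r + 12 * d ≤ n) (hd : 1 ≤ d)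
    (hnd : 10 * n ≤ 2 ^ d) : ∃ D : Word n → TaggedWord k (2 * d), IsBalanced r d D := by
  set Ω := Word n → TaggedWord k (2 * d) with hΩ
  set B : ℝ := 2 * Real.exp (-(2 ^ d)) * Fintype.card Ω with hB
  have hB0 : 0 ≤ B := by positivity
  let Q₁ : Finset (Fin n) × Word n × TaggedWord k (2 * d) → Ω → Prop := fun j D => r ≤ #j.1 ∧
    2 ^ n / 2 ^ r / 2 ^ (k + 2 * d) / 8 ^ d <
      |(#{c ∈ cube j.1 j.2.1 | D c = j.2.2} : ℝ) - 2 ^ n / 2 ^ #j.1 / 2 ^ (k + 2 * d)|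
  let Q₂ : Finset (Fin n) × Word n → Ω → Prop := fun j D => #j.1 + 2 * d ≤ n ∧
    3 * (2 ^ n / 2 ^ #j.1 / 2 ^ d : ℝ) < #{c ∈ cube j.1 j.2 | D c ∈ validLabels k (2 * d)}
  let Q₃ : Finset (Fin n) × Word n × (Fin n → Bool → Bool) × (Fin n × Bool) ×
      TaggedWord k (2 * d) → Ω → Prop := fun j D => #j.1 = r ∧
    (#{y ∈ cube (freeCoords j.1 j.2.2.1)ᶜ (bitwise j.2.2.1 j.2.1) |
        D y ∈ validLabels k (2 * d)} : ℝ) ≤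
      3 * (2 ^ n / 2 ^ #(freeCoords j.1 j.2.2.1)ᶜ / 2 ^ d) ∧
    9 * (2 ^ n / 2 ^ r / 2 ^ (k + 2 * d) / 2 ^ d : ℝ) <
      #(escapesAt D j.1 j.2.1 j.2.2.1 j.2.2.2.1.1 j.2.2.2.1.2 j.2.2.2.2)
  classical
  have h₁ := card_filter_exists_le Q₁ (B := B) fun j => by
    by_cases hj : r ≤ #j.1
    · simpa only [Q₁, hj, true_and] using card_cube_deviation_le hn hd j.1 j.2.1 j.2.2 hj
    · simpa [Q₁, hj] using hB0
  have h₂ := card_filter_exists_le Q₂ (B := B) fun j => by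
    by_cases hj : #j.1 + 2 * d ≤ n
    · simpa only [Q₂, hj, true_and] using card_valid_deviation_le j.1 j.2 hj
    · simpa [Q₂, hj] using hB0
  have h₃ := card_filter_exists_le Q₃ (B := B) fun j => by
    by_cases hj : #j.1 = r
    · simpa only [Q₃, hj, true_and] using
        card_escape_deviation_le hn j.1 j.2.1 j.2.2.1 j.2.2.2.1.1 j.2.2.2.1.2 j.2.2.2.2 hj
    · simpa [Q₃, hj] using hB0
  obtain ⟨D, hD⟩ : ∃ D : Ω, (¬ ∃ j, Q₁ j D) ∧ (¬ ∃ j, Q₂ j D) ∧ ¬ ∃ j, Q₃ j D := by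
    by_contra! hcon
    have hcover : (Finset.univ : Finset Ω) ⊆
        ({D | ∃ j, Q₁ j D} : Finset Ω) ∪ ({D | ∃ j, Q₂ j D} : Finset Ω) ∪
          ({D | ∃ j, Q₃ j D} : Finset Ω) := by
      intro D _
      simp only [Finset.mem_union, Finset.mem_filter, Finset.mem_univ, true_and]
      by_cases hA : ∃ j, Q₁ j D
      · exact Or.inl (Or.inl hA)
      by_cases hA' : ∃ j, Q₂ j D
      · exact Or.inl (Or.inr hA')
      · exact Or.inr (hcon D (not_exists.1 hA) (not_exists.1 hA'))
    have hle := ((Finset.card_le_card hcover).trans (Finset.card_union_le _ _)).trans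
      (Nat.add_le_add_right (Finset.card_union_le _ _) _)
    rw [Finset.card_univ] at hle
    have hle' : (Fintype.card Ω : ℝ) ≤ _ := (Nat.cast_le (α := ℝ)).2 hle
    push_cast at hle'
    have hs : (2 : ℝ) ^ k * 2 ^ (2 * d) ≤ 2 ^ n := by
      rw [← pow_add]; exact pow_le_pow_right₀ one_le_two (by omega)
    have hone : (1 : ℝ) ≤ 2 ^ n := one_le_pow₀ one_le_two
    have hnlt : (n : ℝ) ≤ 2 ^ n := by exact_mod_cast Nat.lt_two_pow_self.le
    have hn2 : (2 : ℝ) ≤ 2 ^ n := le_self_pow₀ one_le_two (by omega)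
    have hc₁ : (Fintype.card (Finset (Fin n) × Word n × TaggedWord k (2 * d)) : ℝ) ≤
        (2 ^ n) ^ 7 := by
      simp only [Fintype.card_prod, Fintype.card_finset, Fintype.card_fin, Fintype.card_fun,
        Fintype.card_bool, Nat.cast_mul, Nat.cast_pow, Nat.cast_ofNat]
      calc (2 : ℝ) ^ n * (2 ^ n * (2 ^ k * 2 ^ (2 * d))) ≤ 2 ^ n * (2 ^ n * 2 ^ n) := by gcongr
        _ = (2 ^ n) ^ 3 := by ring
        _ ≤ _ := pow_le_pow_right₀ hone (by norm_num)
    have hc₂ : (Fintype.card (Finset (Fin n) × Word n) : ℝ) ≤ (2 ^ n) ^ 7 := by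
      simp only [Fintype.card_prod, Fintype.card_finset, Fintype.card_fin, Fintype.card_fun,
        Fintype.card_bool, Nat.cast_mul, Nat.cast_pow, Nat.cast_ofNat]
      calc (2 : ℝ) ^ n * 2 ^ n = (2 ^ n) ^ 2 := by ring
        _ ≤ _ := pow_le_pow_right₀ hone (by norm_num)
    have hc₃ : (Fintype.card (Finset (Fin n) × Word n × (Fin n → Bool → Bool) ×
        (Fin n × Bool) × TaggedWord k (2 * d)) : ℝ) ≤ (2 ^ n) ^ 7 := by
      simp only [Fintype.card_prod, Fintype.card_finset, Fintype.card_fin, Fintype.card_fun,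
        Fintype.card_bool, Nat.cast_mul, Nat.cast_pow, Nat.cast_ofNat]
      calc (2 : ℝ) ^ n * (2 ^ n * ((2 ^ 2) ^ n * (n * 2 * (2 ^ k * 2 ^ (2 * d))))) ≤
          2 ^ n * (2 ^ n * ((2 ^ 2) ^ n * (2 ^ n * 2 ^ n * 2 ^ n))) := by gcongr
        _ = _ := by rw [← pow_mul, ← pow_mul]; ring
    have hΩ0 : (0 : ℝ) < Fintype.card Ω := by exact_mod_cast Fintype.card_pos
    have hexp : (2 ^ n : ℝ) ^ 7 * 8 ≤ Real.exp (2 ^ d) := by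
      have e1 : (2 : ℝ) ≤ Real.exp 1 := by linarith [Real.add_one_le_exp (1 : ℝ)]
      have e2 : ((10 * n : ℕ) : ℝ) ≤ 2 ^ d := by exact_mod_cast hnd
      calc (2 ^ n : ℝ) ^ 7 * 8 = 2 ^ (n * 7 + 3) := by rw [pow_add, pow_mul]; norm_num
        _ ≤ 2 ^ (10 * n) := pow_le_pow_right₀ one_le_two (by omega)
        _ ≤ Real.exp 1 ^ (10 * n) := by gcongr
        _ = Real.exp ((10 * n : ℕ) : ℝ) := by rw [← Real.exp_nat_mul, mul_one]
        _ ≤ _ := Real.exp_le_exp.2 e2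
    have hfin : (2 ^ n : ℝ) ^ 7 * B * 8 ≤ 2 * Fintype.card Ω := by
      rw [hB, Real.exp_neg]
      have : (2 ^ n : ℝ) ^ 7 * (2 * (Real.exp (2 ^ d))⁻¹ * Fintype.card Ω) * 8 =
          ((2 ^ n : ℝ) ^ 7 * 8) / Real.exp (2 ^ d) * (2 * Fintype.card Ω) := by
        field_simp
      rw [this]
      refine mul_le_of_le_one_left (by positivity) ?_
      rwa [div_le_one (Real.exp_pos _)]
    have g₁ := mul_le_mul_of_nonneg_right hc₁ hB0
    have g₂ := mul_le_mul_of_nonneg_right hc₂ hB0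
    have g₃ := mul_le_mul_of_nonneg_right hc₃ hB0
    linarith
  obtain ⟨hD₁, hD₂, hD₃⟩ := hD
  refine ⟨D, ⟨fun A β l hA => ?_, fun S α h l hS hU => ?_⟩⟩
  · by_contra! hlt
    exact hD₁ ⟨(A, β, l), hA, hlt⟩
  · have hvalid : (#{y ∈ cube (freeCoords S h)ᶜ (bitwise h α) |
        D y ∈ validLabels k (2 * d)} : ℝ) ≤
        3 * (2 ^ n / 2 ^ #(freeCoords S h)ᶜ / 2 ^ d) := by
      by_contra! hlt
      refine hD₂ ⟨(_, _), ?_, hlt⟩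
      have := Finset.card_add_card_compl (freeCoords S h)
      simp only [Fintype.card_fin] at this ⊢
      omega
    calc (#(escapes D S α h l) : ℝ)
        ≤ ∑ p : Fin n × Bool, (#(escapesAt D S α h p.1 p.2 l) : ℝ) := by
          exact_mod_cast (Finset.card_le_card (escapes_subset D S α h l)).trans
            Finset.card_biUnion_le
      _ ≤ ∑ _p : Fin n × Bool, 9 * (2 ^ n / 2 ^ r / 2 ^ (k + 2 * d) / 2 ^ d : ℝ) := by
          refine Finset.sum_le_sum fun p _ => ?_
          by_contra! hlt
          exact hD₃ ⟨(S, α, h, p, l), hS, hvalid, hlt⟩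
      _ = _ := by
          simp only [Finset.sum_const, Finset.card_univ, Fintype.card_prod, Fintype.card_fin,
            Fintype.card_bool, nsmul_eq_mul, Nat.cast_mul, Nat.cast_ofNat]
          ring

/-! ### Total discrepancy of a signed weight along a map -/

section Discrepancy

variable {X Y Z : Type*} [DecidableEq Y] [Fintype Z] [DecidableEq Z]

/-- The `ℓ¹`-norm of the pushforward along `φ` of the signed weight `w` restricted to `Q`. -/
def discrepancy (φ : X → Z) (Q : Finset X) (w : X → ℝ) : ℝ :=
  ∑ z, |∑ c ∈ Q with φ c = z, w c|

theorem discrepancy_le_sum_abs (φ : X → Z) (Q : Finset X) (w : X → ℝ) :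
    discrepancy φ Q w ≤ ∑ c ∈ Q, |w c| := by
  rw [← Finset.sum_fiberwise Q φ]
  exact Finset.sum_le_sum fun z _ => Finset.abs_sum_le_sum_abs _ _

theorem discrepancy_le_add (φ : X → Z) (Q : Finset X) (w : X → ℝ) (p : X → Prop)
    [DecidablePred p] :
    discrepancy φ Q w ≤ discrepancy φ {c ∈ Q | p c} w + discrepancy φ {c ∈ Q | ¬ p c} w := by
  unfold discrepancy
  rw [← Finset.sum_add_distrib]
  refine Finset.sum_le_sum fun z _ => ?_
  rw [← Finset.sum_filter_add_sum_filter_not {c ∈ Q | φ c = z} p,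
    Finset.filter_comm (fun c => φ c = z) p,
    Finset.filter_comm (fun c => φ c = z) fun c => ¬ p c]
  exact abs_add_le _ _

theorem discrepancy_filter_not_le (φ : X → Z) (Q : Finset X) (w : X → ℝ) (p : X → Prop)
    [DecidablePred p] :
    discrepancy φ {c ∈ Q | ¬ p c} w ≤ discrepancy φ Q w + discrepancy φ {c ∈ Q | p c} w := by
  unfold discrepancy
  rw [← Finset.sum_add_distrib]
  refine Finset.sum_le_sum fun z _ => ?_
  rw [← Finset.sum_filter_add_sum_filter_not {c ∈ Q | φ c = z} p,
    Finset.filter_comm (fun c => φ c = z) p,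
    Finset.filter_comm (fun c => φ c = z) fun c => ¬ p c]
  refine le_trans (le_of_eq ?_) (abs_sub _ _)
  congr 1
  ring

theorem discrepancy_le_sum {φ : X → Z} {Q : Finset X} {w : X → ℝ} (π : X → Y) (t : Finset Y)
    (hπ : ∀ c ∈ Q, π c ∈ t) :
    discrepancy φ Q w ≤ ∑ y ∈ t, discrepancy φ {c ∈ Q | π c = y} w := by
  unfold discrepancy
  rw [Finset.sum_comm]
  refine Finset.sum_le_sum fun z _ => ?_
  rw [← Finset.sum_fiberwise_of_maps_to (s := {c ∈ Q | φ c = z}) (t := t) (g := π)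
    fun c hc => hπ c (Finset.mem_filter.1 hc).1]
  simp_rw [Finset.filter_comm (fun c => φ c = z)]
  exact Finset.abs_sum_le_sum_abs _ _

theorem discrepancy_le_of_factor [Fintype Y] {φ : X → Z} {Q : Finset X} {w : X → ℝ}
    (π : X → Y) (ψ : Y → Z)
    (hφ : ∀ c ∈ Q, φ c = ψ (π c)) : discrepancy φ Q w ≤ discrepancy π Q w := by
  refine (discrepancy_le_sum π Finset.univ fun _ _ => Finset.mem_univ _).trans
    (Finset.sum_le_sum fun y _ => ?_)
  unfold discrepancy
  rw [Finset.sum_eq_single (ψ y)]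
  · rw [Finset.filter_true_of_mem]
    intro c hc
    rw [Finset.mem_filter] at hc
    rw [hφ c hc.1, hc.2]
  · intro z _ hz
    rw [Finset.filter_false_of_mem, Finset.sum_empty, abs_zero]
    rintro c hc rfl
    rw [Finset.mem_filter] at hc
    exact hz (by rw [hφ c hc.1, hc.2])
  · simp

theorem discrepancy_le_abs_sum_of_const {φ : X → Z} {Q : Finset X} {w : X → ℝ} (z : Z)
    (hφ : ∀ c ∈ Q, φ c = z) : discrepancy φ Q w ≤ |∑ c ∈ Q, w c| := by
  refine (discrepancy_le_of_factor (fun _ => ()) (fun _ => z) hφ).trans (le_of_eq ?_)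
  simp [discrepancy]

end Discrepancy

/-! ### The code of a balanced labelling -/

/-- Decode a word to the message part of its label, if this label is valid. -/
def decodeLabel {n k q : ℕ} (D : Word n → TaggedWord k q) (c : Word n) : Option (Word k) :=
  if D c ∈ validLabels k q then some (D c).1 else none

/-- The outcome of the strong tampering experiment on the codeword `c`. -/
def tamperOutcome {n k : ℕ} (Dec : Word n → Option (Word k)) (f : Word n → Word n)
    (c : Word n) : NMOut k :=
  if f c = c then Sum.inr true
  else
    match Dec (f c) with
    | some m' => Sum.inl m'
    | none => Sum.inr false

/-- The difference of the indicator functions of two labels. -/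
def labelDiff {n k q : ℕ} (D : Word n → TaggedWord k q) (l₀ l₁ : TaggedWord k q)
    (c : Word n) : ℝ :=
  (if D c = l₀ then 1 else 0) - (if D c = l₁ then 1 else 0)

theorem sum_labelDiff {n k q : ℕ} (D : Word n → TaggedWord k q) (l₀ l₁ : TaggedWord k q)
    (Q : Finset (Word n)) :
    ∑ c ∈ Q, labelDiff D l₀ l₁ c = #{c ∈ Q | D c = l₀} - #{c ∈ Q | D c = l₁} := by
  simp [labelDiff, Finset.sum_sub_distrib]

theorem sum_abs_labelDiff_le {n k q : ℕ} (D : Word n → TaggedWord k q) (l₀ l₁ : TaggedWord k q)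
    (Q : Finset (Word n)) :
    ∑ c ∈ Q, |labelDiff D l₀ l₁ c| ≤ #{c ∈ Q | D c = l₀} + #{c ∈ Q | D c = l₁} := by
  have : (#{c ∈ Q | D c = l₀} : ℝ) + #{c ∈ Q | D c = l₁} =
      ∑ c ∈ Q, ((if D c = l₀ then 1 else 0) + (if D c = l₁ then 1 else 0)) := by
    simp [Finset.sum_add_distrib]
  rw [this]
  refine Finset.sum_le_sum fun c _ => ?_
  unfold labelDiff
  split_ifs <;> norm_num

/-- The fixed points of a bitwise map in a subcube form a subcube, or there are none. -/
theorem filter_bitwise_eq_self {n : ℕ} (S : Finset (Fin n)) (α : Word n)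
    (h : Fin n → Bool → Bool) :
    ({c ∈ cube S α | bitwise h c = c} : Finset (Word n)) = ∅ ∨
      ∃ γ, ({c ∈ cube S α | bitwise h c = c} : Finset (Word n)) = cube (freeCoords S h)ᶜ γ := by
  rcases Finset.eq_empty_or_nonempty {c ∈ cube S α | bitwise h c = c} with he | ⟨γ, hγ⟩
  · exact Or.inl he
  refine Or.inr ⟨γ, ?_⟩
  obtain ⟨hγS, hγ⟩ := Finset.mem_filter.1 hγ
  ext c
  rw [Finset.mem_filter, mem_cube, mem_cube]
  constructor
  · rintro ⟨hcS, hc⟩ i hi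
    rw [← congrFun hc i, ← congrFun hγ i]
    exact bitwise_eq_of_notMem_freeCoords (Finset.mem_compl.1 hi) fun hS => by
      rw [hcS i hS, mem_cube.1 hγS i hS]
  · intro hc
    refine ⟨fun i hi => ?_, funext fun i => ?_⟩
    · rw [hc i, mem_cube.1 hγS i hi]
      exact Finset.mem_compl.2 (Finset.disjoint_left.1 (disjoint_freeCoords S h) hi)
    · have hγi : h i (γ i) = γ i := congrFun hγ i
      by_cases hi : i ∈ freeCoords S h
      · have hne := (Finset.mem_filter.1 hi).2.2
        simp only [bitwise]
        cases hx : γ i <;> cases hy : c i <;> simp_all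
      · simp only [bitwise]
        rw [hc i (Finset.mem_compl.2 hi), hγi]

theorem card_le_card_compl_freeCoords {n r : ℕ} {S : Finset (Fin n)} (hS : #S = r)
    (h : Fin n → Bool → Bool) : r ≤ #(freeCoords S h)ᶜ := by
  rw [← hS]
  exact Finset.card_le_card fun i hi =>
    Finset.mem_compl.2 (Finset.disjoint_left.1 (disjoint_freeCoords S h) hi)

section Balanced

variable {n k r d : ℕ} {D : Word n → TaggedWord k (2 * d)}

theorem IsBalanced.abs_sum_cube_le (hD : IsBalanced r d D) (l₀ l₁ : TaggedWord k (2 * d))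
    (A : Finset (Fin n)) (β : Word n) (hA : r ≤ #A) :
    |∑ c ∈ cube A β, labelDiff D l₀ l₁ c| ≤
      2 * (2 ^ n / 2 ^ r / 2 ^ (k + 2 * d) / 8 ^ d) := by
  rw [sum_labelDiff]
  have h₀ := abs_le.1 (hD.cube_count A β l₀ hA)
  have h₁ := abs_le.1 (hD.cube_count A β l₁ hA)
  rw [abs_le]
  constructor <;> linarith

theorem IsBalanced.discrepancy_le_of_many_free (hD : IsBalanced r d D)
    (l₀ l₁ : TaggedWord k (2 * d)) (S : Finset (Fin n)) (hS : #S = r) (α : Word n)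
    (h : Fin n → Bool → Bool) (hU : 2 * d ≤ #(freeCoords S h)) :
    discrepancy (tamperOutcome (decodeLabel D) (bitwise h)) (cube S α) (labelDiff D l₀ l₁) ≤
      6 * (2 ^ n / 2 ^ r / 2 ^ (k + 2 * d) / 8 ^ d) +
        72 * n * (2 ^ n / 2 ^ r / 2 ^ (k + 2 * d) / 2 ^ d) := by
  set a : ℝ := 2 ^ n / 2 ^ r / 2 ^ (k + 2 * d) / 8 ^ d with ha
  have ha0 : 0 ≤ a := by positivity
  set w := labelDiff D l₀ l₁ with hw
  set out := tamperOutcome (decodeLabel D) (bitwise h) with hout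
  set Q := cube S α
  set F : Finset (Word n) := {c ∈ Q | bitwise h c = c} with hF
  set R : Finset (Word n) := {c ∈ Q | ¬ bitwise h c = c} with hR
  set V : Finset (Word n) := {c ∈ R | D (bitwise h c) ∈ validLabels k (2 * d)} with hV
  set N : Finset (Word n) := {c ∈ R | ¬ D (bitwise h c) ∈ validLabels k (2 * d)} with hN
  have hsumF : |∑ c ∈ F, w c| ≤ 2 * a := by
    rcases filter_bitwise_eq_self S α h with he | ⟨γ, hγ⟩
    · rw [hF, he]; simpa using ha0
    · rw [hF, hγ]; exact hD.abs_sum_cube_le l₀ l₁ _ _ (card_le_card_compl_freeCoords hS h)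
  have hsumQ : |∑ c ∈ Q, w c| ≤ 2 * a := hD.abs_sum_cube_le l₀ l₁ S α hS.ge
  have hesc (l : TaggedWord k (2 * d)) : ({c ∈ V | D c = l} : Finset _) = escapes D S α h l := by
    ext c
    simp only [hV, hR, escapes, Finset.mem_filter]
    tauto
  have hsumV : ∑ c ∈ V, |w c| ≤ 36 * n * (2 ^ n / 2 ^ r / 2 ^ (k + 2 * d) / 2 ^ d) := by
    refine (sum_abs_labelDiff_le D l₀ l₁ V).trans ?_
    rw [hesc, hesc]
    linarith [hD.escape_count S α h l₀ hS hU, hD.escape_count S α h l₁ hS hU]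
  have hdF : discrepancy out F w ≤ |∑ c ∈ F, w c| :=
    discrepancy_le_abs_sum_of_const (Sum.inr true) fun c hc => by
      simp [hout, tamperOutcome, (Finset.mem_filter.1 hc).2]
  have hdN : discrepancy out N w ≤ |∑ c ∈ N, w c| :=
    discrepancy_le_abs_sum_of_const (Sum.inr false) fun c hc => by
      have h1 := (Finset.mem_filter.1 hc).2
      have h2 := (Finset.mem_filter.1 (Finset.mem_filter.1 hc).1).2
      simp [hout, tamperOutcome, decodeLabel, h1, h2]
  have hsplit₁ : ∑ c ∈ F, w c + ∑ c ∈ R, w c = ∑ c ∈ Q, w c :=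
    Finset.sum_filter_add_sum_filter_not _ _ _
  have hsplit₂ : ∑ c ∈ V, w c + ∑ c ∈ N, w c = ∑ c ∈ R, w c :=
    Finset.sum_filter_add_sum_filter_not _ _ _
  have hVabs := Finset.abs_sum_le_sum_abs w V
  have hsumN : |∑ c ∈ N, w c| ≤
      |∑ c ∈ Q, w c| + |∑ c ∈ F, w c| + |∑ c ∈ V, w c| := by
    have : ∑ c ∈ N, w c = ∑ c ∈ Q, w c - ∑ c ∈ F, w c - ∑ c ∈ V, w c := by linarith
    rw [this]
    exact (abs_sub _ _).trans (add_le_add_left (abs_sub _ _) _)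
  have h1 := discrepancy_le_add out Q w fun c => bitwise h c = c
  have h2 := discrepancy_le_add out R w fun c => D (bitwise h c) ∈ validLabels k (2 * d)
  have h3 := discrepancy_le_sum_abs out V w
  linarith

theorem IsBalanced.discrepancy_le_of_few_free (hD : IsBalanced r d D)
    (hn : k + r + 12 * d ≤ n) (l₀ l₁ : TaggedWord k (2 * d)) (S : Finset (Fin n)) (hS : #S = r)
    (α : Word n) (h : Fin n → Bool → Bool) (hU : #(freeCoords S h) ≤ 2 * d) :
    discrepancy (tamperOutcome (decodeLabel D) (bitwise h)) (cube S α) (labelDiff D l₀ l₁) ≤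
      8 * (2 ^ n / 2 ^ r / 2 ^ (k + 2 * d) / 8 ^ d) +
        2 * (2 ^ n / 2 ^ r / 2 ^ (k + 2 * d) / 2 ^ d) := by
  set a : ℝ := 2 ^ n / 2 ^ r / 2 ^ (k + 2 * d) / 8 ^ d with ha
  set w := labelDiff D l₀ l₁ with hw
  set out := tamperOutcome (decodeLabel D) (bitwise h) with hout
  set Q := cube S α
  set U := freeCoords S h with hUdef
  set F : Finset (Word n) := {c ∈ Q | bitwise h c = c} with hF
  set R : Finset (Word n) := {c ∈ Q | ¬ bitwise h c = c} with hR
  have hru : r + #U ≤ n := by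
    rw [← hS, ← Finset.card_union_of_disjoint (disjoint_freeCoords S h)]
    simpa using card_le_univ (S ∪ U)
  have hUc : #Uᶜ = n - #U := by simp [Finset.card_compl]
  have hcountF (l : TaggedWord k (2 * d)) : (#{c ∈ F | D c = l} : ℝ) ≤ 2 * a := by
    have hsub : ({c ∈ F | D c = l} : Finset _) ⊆ {c ∈ cube Uᶜ (bitwise h α) | D c = l} :=
      Finset.filter_subset_filter _ fun c hc => by
        obtain ⟨hc1, hc2⟩ := Finset.mem_filter.1 hc
        rw [← hc2]
        exact bitwise_mem_cube hc1
    refine (Nat.cast_le (α := ℝ).2 (Finset.card_le_card hsub)).trans ?_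
    have hc := (abs_le.1 (hD.cube_count Uᶜ (bitwise h α) l (card_le_card_compl_freeCoords hS h))).2
    have hle : (2 : ℝ) ^ n / 2 ^ #Uᶜ / 2 ^ (k + 2 * d) ≤ a := by
      rw [hUc, ha, pow_sub₀ _ two_ne_zero (by omega : #U ≤ n), div_right_comm _ _ (8 ^ d : ℝ)]
      refine div_le_div_of_nonneg_right ?_ (by positivity)
      rw [le_div_iff₀ (by positivity), le_div_iff₀ (by positivity)]
      have h8 : (8 : ℝ) ^ d = 2 ^ (3 * d) := by rw [pow_mul]; norm_num
      have : (2 : ℝ) ^ n / (2 ^ n * (2 ^ #U)⁻¹) = 2 ^ #U := by field_simp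
      rw [this, h8, ← pow_add, ← pow_add]
      exact pow_le_pow_right₀ one_le_two (by omega)
    linarith
  have hsumF : ∑ c ∈ F, |w c| ≤ 4 * a := by
    linarith [sum_abs_labelDiff_le D l₀ l₁ F, hcountF l₀, hcountF l₁]
  let π : Word n → Word n := fun c i => if i ∈ U then c i else α i
  have hπ {c : Word n} (hc : c ∈ Q) : bitwise h (π c) = bitwise h c := by
    funext i
    by_cases hi : i ∈ U
    · simp [bitwise, π, hi]
    · simp only [bitwise, π, hi, if_false]
      exact bitwise_eq_of_notMem_freeCoords hi fun hiS => (mem_cube.1 hc i hiS).symm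
  have hdR : discrepancy out R w ≤ discrepancy π R w :=
    discrepancy_le_of_factor π (fun j => match decodeLabel D (bitwise h j) with
      | some m' => (Sum.inl m' : NMOut k)
      | none => Sum.inr false) fun c hc => by
      obtain ⟨hc1, hc2⟩ := Finset.mem_filter.1 hc
      simp only [hout, tamperOutcome, hc2, if_false, hπ hc1]
  have hdQ : discrepancy π Q w ≤ 2 * (2 ^ n / 2 ^ r / 2 ^ (k + 2 * d) / 2 ^ d) := by
    have hzero : ∀ j ∉ cube Uᶜ α, |∑ c ∈ Q with π c = j, w c| = 0 := by
      intro j hj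
      rw [Finset.filter_false_of_mem, Finset.sum_empty, abs_zero]
      rintro c - rfl
      exact hj (mem_cube.2 fun i hi => by simp [π, Finset.mem_compl.1 hi])
    have hcell : ∀ j ∈ cube Uᶜ α, |∑ c ∈ Q with π c = j, w c| ≤ 2 * a := by
      intro j hj
      have : ({c ∈ Q | π c = j} : Finset _) = cube (S ∪ U) j := by
        ext c
        rw [Finset.mem_filter, mem_cube, mem_cube]
        constructor
        · rintro ⟨hc, rfl⟩ i hi
          by_cases hiU : i ∈ U
          · simp [π, hiU]
          · simpa [π, hiU] using hc i ((Finset.mem_union.1 hi).resolve_right hiU)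
        · intro hc
          refine ⟨fun i hi => ?_, funext fun i => ?_⟩
          · rw [hc i (Finset.mem_union_left _ hi)]
            exact mem_cube.1 hj i
              (Finset.mem_compl.2 (Finset.disjoint_left.1 (disjoint_freeCoords S h) hi))
          · by_cases hiU : i ∈ U
            · simpa [π, hiU] using hc i (Finset.mem_union_right _ hiU)
            · simpa [π, hiU] using (mem_cube.1 hj i (Finset.mem_compl.2 hiU)).symm
      rw [this]
      exact hD.abs_sum_cube_le l₀ l₁ _ _
        (hS.ge.trans (Finset.card_le_card Finset.subset_union_left))
    calc discrepancy π Q w = ∑ j ∈ cube Uᶜ α, |∑ c ∈ Q with π c = j, w c| :=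
          (Finset.sum_subset (Finset.subset_univ _) fun j _ hj => hzero j hj).symm
      _ ≤ ∑ _j ∈ cube Uᶜ α, 2 * a := Finset.sum_le_sum hcell
      _ = 2 ^ #U * (2 * a) := by
          rw [Finset.sum_const, card_cube, hUc, Nat.sub_sub_self (by omega), nsmul_eq_mul]
          push_cast
          rfl
      _ ≤ 2 ^ (2 * d) * (2 * a) := by gcongr; exact one_le_two
      _ = _ := by
          have h8 : (8 : ℝ) ^ d = 2 ^ (2 * d) * 2 ^ d := by
            rw [pow_mul, ← mul_pow]; norm_num
          rw [ha, h8]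
          field_simp
  have h1 := discrepancy_le_add out Q w fun c => bitwise h c = c
  have h2 := discrepancy_filter_not_le π Q w fun c => bitwise h c = c
  have h3 := discrepancy_le_sum_abs out F w
  have h4 := discrepancy_le_sum_abs π F w
  linarith

theorem IsBalanced.discrepancy_cube_le (hD : IsBalanced r d D) (hn : k + r + 12 * d ≤ n)
    (hd : 1 ≤ d) (l₀ l₁ : TaggedWord k (2 * d)) (S : Finset (Fin n)) (hS : #S = r) (α : Word n)
    (h : Fin n → Bool → Bool) :
    discrepancy (tamperOutcome (decodeLabel D) (bitwise h)) (cube S α) (labelDiff D l₀ l₁) ≤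
      78 * n * (2 ^ n / 2 ^ r / 2 ^ (k + 2 * d) / 2 ^ d) := by
  have hle : (2 : ℝ) ^ n / 2 ^ r / 2 ^ (k + 2 * d) / 8 ^ d ≤
      2 ^ n / 2 ^ r / 2 ^ (k + 2 * d) / 2 ^ d := by gcongr; norm_num
  have hpos : (0 : ℝ) ≤ 2 ^ n / 2 ^ r / 2 ^ (k + 2 * d) / 2 ^ d := by positivity
  have hn1 : (1 : ℝ) ≤ n := by exact_mod_cast (by omega : 1 ≤ n)
  set b : ℝ := 2 ^ n / 2 ^ r / 2 ^ (k + 2 * d) / 2 ^ d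
  rcases le_total (2 * d) #(freeCoords S h) with hU | hU
  · have := hD.discrepancy_le_of_many_free l₀ l₁ S hS α h hU
    nlinarith
  · have := hD.discrepancy_le_of_few_free hn l₀ l₁ S hS α h hU
    nlinarith

theorem exists_partition_into_cubes (S : Finset (Fin n)) (hS : #S = r) :
    ∃ (π : Word n → Word n) (t : Finset (Word n)), #t = 2 ^ r ∧ (∀ c, π c ∈ t) ∧
      ∀ α ∈ t, ({c | π c = α} : Finset (Word n)) = cube S α := by
  refine ⟨fun c i => if i ∈ S then c i else false, cube Sᶜ fun _ => false, ?_, fun c => ?_,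
    fun α hα => ?_⟩
  · have : r ≤ n := by simpa [hS] using card_le_univ S
    rw [card_cube, Finset.card_compl, Fintype.card_fin, hS, Nat.sub_sub_self this]
  · exact mem_cube.2 fun i hi => by simp [Finset.mem_compl.1 hi]
  · ext c
    simp only [Finset.mem_filter, Finset.mem_univ, true_and, mem_cube]
    constructor
    · rintro rfl i hi
      simp [hi]
    · intro hc
      funext i
      by_cases hi : i ∈ S
      · simp [hi, hc]
      · simp [hi, mem_cube.1 hα i (Finset.mem_compl.2 hi)]

theorem IsBalanced.card_label_ge (hD : IsBalanced r d D) (hd : 1 ≤ d) (hr : r ≤ n)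
    (l : TaggedWord k (2 * d)) :
    (2 : ℝ) ^ r * (2 ^ n / 2 ^ r / 2 ^ (k + 2 * d)) / 2 ≤ #{c | D c = l} := by
  obtain ⟨S, -, hS⟩ := Finset.exists_subset_card_eq (s := (Finset.univ : Finset (Fin n)))
    (n := r) (by simpa using hr)
  obtain ⟨π, t, ht, hπ, hcube⟩ := exists_partition_into_cubes S hS
  set τ : ℝ := 2 ^ n / 2 ^ r / 2 ^ (k + 2 * d) with hτ
  have hτ0 : 0 ≤ τ := by positivity
  have h8 : τ / 8 ^ d ≤ τ / 2 := by
    gcongr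
    exact le_trans (by norm_num) (le_self_pow₀ (by norm_num : (1 : ℝ) ≤ 8) (by omega))
  have hcard : #{c | D c = l} = ∑ α ∈ t, #{c ∈ cube S α | D c = l} := by
    rw [Finset.card_eq_sum_card_fiberwise (f := π) (t := t) fun c _ => hπ c]
    refine Finset.sum_congr rfl fun α hα => ?_
    rw [← hcube α hα, Finset.filter_filter, Finset.filter_filter]
    simp_rw [and_comm]
  rw [hcard]
  push_cast
  calc (2 : ℝ) ^ r * τ / 2 = ∑ _α ∈ t, τ / 2 := by
        rw [Finset.sum_const, ht, nsmul_eq_mul]; push_cast; ring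
    _ ≤ _ := Finset.sum_le_sum fun α _ => by
        have := (abs_le.1 (hD.cube_count S α l hS.ge)).1
        rw [hS] at this
        linarith

theorem IsBalanced.discrepancy_univ_le (hD : IsBalanced r d D) (hn : k + r + 12 * d ≤ n)
    (hd : 1 ≤ d) (l₀ l₁ : TaggedWord k (2 * d)) {w : ℕ} {f : Word n → Word n}
    (hf : f ∈ FBIT n r w) :
    discrepancy (tamperOutcome (decodeLabel D) f) Finset.univ (labelDiff D l₀ l₁) ≤
      2 ^ r * (78 * n * (2 ^ n / 2 ^ r / 2 ^ (k + 2 * d) / 2 ^ d)) := by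
  obtain ⟨S, T, hS, -, g, hg⟩ := hf
  obtain ⟨π, t, ht, hπ, hcube⟩ := exists_partition_into_cubes S hS
  refine (discrepancy_le_sum π t fun c _ => hπ c).trans ?_
  refine (Finset.sum_le_card_nsmul t _ (78 * n * (2 ^ n / 2 ^ r / 2 ^ (k + 2 * d) / 2 ^ d) : ℝ)
    fun α hα => ?_).trans (le_of_eq (by rw [ht, nsmul_eq_mul]; push_cast; rfl))
  rw [hcube α hα]
  set h : Fin n → Bool → Bool := fun i x =>
    if hi : i ∈ T then g (fun j => α j.1) ⟨i, hi⟩ x else x with hh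
  have hfh : ∀ c ∈ cube S α, f c = bitwise h c := fun c hc => by
    funext i
    have : (fun j : {i : Fin n // i ∈ S} => c j.1) = fun j => α j.1 :=
      funext fun j => mem_cube.1 hc j.1 j.2
    rw [hg, this]
    rfl
  have hcongr : discrepancy (tamperOutcome (decodeLabel D) f) (cube S α) (labelDiff D l₀ l₁) =
      discrepancy (tamperOutcome (decodeLabel D) (bitwise h)) (cube S α)
        (labelDiff D l₀ l₁) := by
    refine Finset.sum_congr rfl fun z _ => ?_
    congr 2
    refine Finset.filter_congr fun c hc => ?_
    simp only [tamperOutcome, hfh c hc]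
  rw [hcongr]
  exact hD.discrepancy_cube_le hn hd l₀ l₁ S hS α h

end Balanced

theorem map_uniformOfFinset_apply_toReal {X Z : Type*} [Fintype X] [DecidableEq Z]
    (G : Finset X) (hG : G.Nonempty) (φ : X → Z) (z : Z) :
    (((PMF.uniformOfFinset G hG).map φ) z).toReal = (#{c ∈ G | φ c = z} : ℝ) / #G := by
  classical
  have h (c : X) : (if z = φ c then (PMF.uniformOfFinset G hG) c else 0) =
      if c ∈ ({c ∈ G | φ c = z} : Finset X) then (#G : ENNReal)⁻¹ else 0 := by
    rw [PMF.uniformOfFinset_apply]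
    by_cases h1 : c ∈ G <;> by_cases h2 : φ c = z <;> simp [h1, h2, eq_comm (a := z)]
  rw [PMF.map_apply, tsum_fintype]
  trans (∑ c : X, if c ∈ ({c ∈ G | φ c = z} : Finset X) then (#G : ENNReal)⁻¹ else 0).toReal
  · congr 1
    refine Finset.sum_congr rfl fun c _ => ?_
    convert h c
  · rw [Finset.sum_ite_mem, Finset.univ_inter, Finset.sum_const, nsmul_eq_mul,
      ENNReal.toReal_mul, ENNReal.toReal_natCast, ENNReal.toReal_inv, ENNReal.toReal_natCast,
      div_eq_mul_inv]

theorem sum_abs_div_sub_div_le {Z : Type*} [Fintype Z] (x y : Z → ℝ) {a b : ℝ}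
    (hy : ∀ z, 0 ≤ y z) (hxa : ∑ z, x z = a) (hyb : ∑ z, y z = b) (ha : 0 < a) (hb : 0 < b) :
    ∑ z, |x z / a - y z / b| ≤ 2 * ((∑ z, |x z - y z|) / a) := by
  have hdiff : |b - a| ≤ ∑ z, |x z - y z| := by
    rw [abs_sub_comm, ← hxa, ← hyb, ← Finset.sum_sub_distrib]
    exact Finset.abs_sum_le_sum_abs _ _
  have hterm (z : Z) : |x z / a - y z / b| ≤
      |x z - y z| / a + y z * (|b - a| / (a * b)) := by
    have : x z / a - y z / b = (x z - y z) / a + y z * ((b - a) / (a * b)) := by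
      field_simp; ring
    rw [this]
    refine (abs_add_le _ _).trans (le_of_eq ?_)
    rw [abs_div, abs_mul, abs_div, abs_of_nonneg (hy z), abs_of_pos ha,
      abs_of_pos (mul_pos ha hb)]
  have hsum := Finset.sum_le_sum fun z (_ : z ∈ Finset.univ) => hterm z
  rw [Finset.sum_add_distrib, ← Finset.sum_div, ← Finset.sum_mul, hyb] at hsum
  have hlast : b * (|b - a| / (a * b)) ≤ (∑ z, |x z - y z|) / a := by
    have : b * (|b - a| / (a * b)) = |b - a| / a := by field_simp
    rw [this]
    gcongr
  linarith

theorem SD_map_uniformOfFinset_le {X Z : Type*} [Fintype X] [Fintype Z] [DecidableEq Z]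
    (G₀ G₁ : Finset X) (h₀ : G₀.Nonempty) (h₁ : G₁.Nonempty) (φ : X → Z) :
    SD ((PMF.uniformOfFinset G₀ h₀).map φ) ((PMF.uniformOfFinset G₁ h₁).map φ) ≤
      (∑ z, |(#{c ∈ G₀ | φ c = z} : ℝ) - #{c ∈ G₁ | φ c = z}|) / #G₀ := by
  have e (G : Finset X) : ∑ z, (#{c ∈ G | φ c = z} : ℝ) = #G := by
    exact_mod_cast (Finset.card_eq_sum_card_fiberwise (t := Finset.univ)
      fun c _ => Finset.mem_univ (φ c)).symm
  have key := sum_abs_div_sub_div_le (fun z => (#{c ∈ G₀ | φ c = z} : ℝ))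
    (fun z => (#{c ∈ G₁ | φ c = z} : ℝ)) (fun _ => Nat.cast_nonneg _) (e G₀) (e G₁)
    (Nat.cast_pos.2 h₀.card_pos) (Nat.cast_pos.2 h₁.card_pos)
  unfold SD
  simp_rw [map_uniformOfFinset_apply_toReal]
  linarith

theorem exists_strongNM_code {n k r d : ℕ} (hn : k + r + 12 * d ≤ n) (hd : 1 ≤ d)
    (hnd : 10 * n ≤ 2 ^ d) :
    ∃ (Enc : Word k → PMF (Word n)) (Dec : Word n → Option (Word k)), Correct Enc Dec ∧
      ∀ w, StronglyNonMalleable Enc Dec (FBIT n r w) (156 * n / 2 ^ d) := by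
  obtain ⟨D, hD⟩ := exists_isBalanced (k := k) (r := r) hn hd hnd
  let l : Word k → TaggedWord k (2 * d) := fun m => (m, fun _ => false)
  let G : Word k → Finset (Word n) := fun m => {c | D c = l m}
  have hsize (m : Word k) :
      (2 : ℝ) ^ r * (2 ^ n / 2 ^ r / 2 ^ (k + 2 * d)) / 2 ≤ #(G m) :=
    hD.card_label_ge hd (by omega) (l m)
  have hG (m : Word k) : (G m).Nonempty := by
    rw [← Finset.card_pos, ← Nat.cast_pos (α := ℝ)]
    exact lt_of_lt_of_le (by positivity) (hsize m)
  refine ⟨fun m => PMF.uniformOfFinset (G m) (hG m), decodeLabel D, fun m c hc => ?_,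
    fun w f hf m₀ m₁ => ?_⟩
  · have hc' : D c = l m := by
      rw [PMF.mem_support_uniformOfFinset_iff] at hc
      exact (Finset.mem_filter.1 hc).2
    simp [decodeLabel, hc', mem_validLabels, l]
  · have hdisc := hD.discrepancy_univ_le hn hd (l m₀) (l m₁) hf
    have hnum : ∑ z, |(#{c ∈ G m₀ | tamperOutcome (decodeLabel D) f c = z} : ℝ) -
        #{c ∈ G m₁ | tamperOutcome (decodeLabel D) f c = z}| =
        discrepancy (tamperOutcome (decodeLabel D) f) Finset.univ
          (labelDiff D (l m₀) (l m₁)) := by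
      refine Finset.sum_congr rfl fun z _ => ?_
      rw [sum_labelDiff, Finset.filter_comm, Finset.filter_comm (p := fun c => D c = l m₁)]
    refine (SD_map_uniformOfFinset_le (G m₀) (G m₁) (hG m₀) (hG m₁)
      (tamperOutcome (decodeLabel D) f)).trans ?_
    rw [hnum]
    refine (div_le_div_of_nonneg_right hdisc (Nat.cast_nonneg _)).trans ?_
    refine (div_le_div_of_nonneg_left (by positivity) (by positivity) (hsize m₀)).trans
      (le_of_eq ?_)
    field_simp
    ring

/-- For constants `ρ_r, ρ_w ∈ (0,1]` and `ξ ∈ (0,1)` with `ρ_r + ξ < 1`, for all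
large enough `n` there is a `(k,n)`-coding scheme of rate at least `1 - ρ_r - ξ`
that is strongly non-malleable with respect to `F_BIT^{[n],⌊nρ_r⌋,⌊nρ_w⌋}` with
exponentially small exact security. -/
theorem strongNM_rate_lower_bound
    (ρr ρw ξ : ℝ) (hρr0 : 0 < ρr) (hρr1 : ρr ≤ 1) (hρw0 : 0 < ρw) (hρw1 : ρw ≤ 1)
    (hξ0 : 0 < ξ) (hξ1 : ξ < 1) (hsum : ρr + ξ < 1) :
    ∃ c : ℝ, 0 < c ∧ ∃ n0 : ℕ, ∀ n : ℕ, n0 ≤ n →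
      ∃ (k : ℕ) (Enc : Word k → PMF (Word n)) (Dec : Word n → Option (Word k)),
        (n : ℝ) * (1 - ρr - ξ) ≤ (k : ℝ) ∧
        Correct Enc Dec ∧
        StronglyNonMalleable Enc Dec
          (FBIT n ⌊(n : ℝ) * ρr⌋₊ ⌊(n : ℝ) * ρw⌋₊)
          ((2 : ℝ) ^ (-(c * (n : ℝ)))) := by
  have hbase : (1 : ℝ) < 2 ^ (ξ / 48) := Real.one_lt_rpow one_lt_two (by positivity)
  have hlim : ∀ᶠ n : ℕ in Filter.atTop, 312 * (n : ℝ) ≤ ((2 : ℝ) ^ (ξ / 48)) ^ n := by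
    have h := (isLittleO_coe_const_pow_of_one_lt (R := ℝ) hbase).bound
      (c := 1 / 312) (by norm_num)
    filter_upwards [h] with n hn
    rw [Real.norm_natCast, Real.norm_of_nonneg (by positivity)] at hn
    linarith
  obtain ⟨n₁, hn₁⟩ := Filter.eventually_atTop.1 hlim
  refine ⟨ξ / 48, by positivity, max n₁ ⌈24 / ξ⌉₊, fun n hn => ?_⟩
  have hgrow := hn₁ n ((le_max_left _ _).trans hn)
  have hnξ : 24 ≤ ξ * n := by
    have h1 : (24 / ξ : ℝ) ≤ n := Nat.ceil_le.1 ((le_max_right _ _).trans hn)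
    rwa [div_le_iff₀' hξ0] at h1
  set d := ⌊ξ * n / 24⌋₊ with hd
  set k := ⌈(n : ℝ) * (1 - ρr - ξ)⌉₊ with hk
  set r := ⌊(n : ℝ) * ρr⌋₊ with hr
  have hd1 : 1 ≤ d := Nat.le_floor (by rw [Nat.cast_one, le_div_iff₀ (by norm_num)]; linarith)
  have hdle : (d : ℝ) ≤ ξ * n / 24 := Nat.floor_le (by positivity)
  have hdgt : ξ * n / 24 < d + 1 := Nat.lt_floor_add_one _
  have hrle : (r : ℝ) ≤ n * ρr := Nat.floor_le (by positivity)
  have hklt : (k : ℝ) < n * (1 - ρr - ξ) + 1 :=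
    Nat.ceil_lt_add_one (mul_nonneg (Nat.cast_nonneg _) (by linarith))
  have hkrd : k + r + 12 * d ≤ n := by
    have : ((k + r + 12 * d : ℕ) : ℝ) ≤ n := by
      push_cast
      nlinarith
    exact_mod_cast this
  have hsq : (((2 : ℝ) ^ (ξ / 48)) ^ n) ^ 2 ≤ 2 * 2 ^ d := by
    have e1 : (((2 : ℝ) ^ (ξ / 48)) ^ n) ^ 2 = (2 : ℝ) ^ (ξ * n / 24) := by
      rw [← pow_mul, ← Real.rpow_mul_natCast zero_le_two]
      congr 1
      push_cast
      ring
    have e2 : (2 : ℝ) * 2 ^ d = (2 : ℝ) ^ ((d : ℝ) + 1) := by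
      rw [Real.rpow_add_one two_ne_zero, Real.rpow_natCast, mul_comm]
    rw [e1, e2]
    exact Real.rpow_le_rpow_of_exponent_le one_le_two hdgt.le
  have hneg : (2 : ℝ) ^ (-(ξ / 48 * (n : ℝ))) = (((2 : ℝ) ^ (ξ / 48)) ^ n)⁻¹ := by
    rw [Real.rpow_neg zero_le_two, Real.rpow_mul_natCast zero_le_two]
  set x : ℝ := ((2 : ℝ) ^ (ξ / 48)) ^ n with hx
  have hx1 : 1 ≤ x := one_le_pow₀ hbase.le
  have hnd : 10 * n ≤ 2 ^ d := by
    have : ((10 * n : ℕ) : ℝ) ≤ (2 ^ d : ℕ) := by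
      push_cast
      nlinarith
    exact_mod_cast this
  obtain ⟨Enc, Dec, hcorrect, hNM⟩ := exists_strongNM_code hkrd hd1 hnd
  refine ⟨k, Enc, Dec, Nat.le_ceil _, hcorrect, fun f hf m₀ m₁ =>
    (hNM _ f hf m₀ m₁).trans ?_⟩
  rw [hneg, ← one_div, div_le_div_iff₀ (by positivity) (by positivity)]
  nlinarith
end

section
/- Let (Enc,Dec) be a (k,n)-coding scheme and let r ≤ n. Suppose the scheme has perfect wiretap II secrecy with leakage budget r: for every set S ⊆ [n] with |S| ≤ r and all messages m0, m1 ∈ {0,1}^k, SD(Enc(m0)_S ; Enc(m1)_S) = 0. Then k ≤ n − r. -/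
theorem eq_of_SD_eq_zero {Z : Type*} [Fintype Z] {X Y : PMF Z} (h : SD X Y = 0) : X = Y := by
  have hsum : ∑ z, |(X z).toReal - (Y z).toReal| = 0 := by
    unfold SD at h
    linarith
  rw [Finset.sum_eq_zero_iff_of_nonneg fun z _ => abs_nonneg _] at hsum
  ext z
  have hz := abs_eq_zero.mp (hsum z (Finset.mem_univ z))
  exact (ENNReal.toReal_eq_toReal_iff' (X.apply_ne_top z) (Y.apply_ne_top z)).mp
    (sub_eq_zero.mp hz)

/-- Perfect wiretap II secrecy with leakage budget `r` implies `k ≤ n - r`. -/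
theorem perfect_secrecy_rate_upper_bound
    (k n r : ℕ) (hrn : r ≤ n)
    (Enc : Word k → PMF (Word n)) (Dec : Word n → Option (Word k))
    (hcorrect : Correct Enc Dec)
    (hsec : ∀ S : Finset (Fin n), S.card ≤ r → ∀ m0 m1 : Word k,
      SD (restrictPMF S (Enc m0)) (restrictPMF S (Enc m1)) = 0) :
    k ≤ n - r := by
  obtain ⟨S, -, hS⟩ := Finset.exists_subset_card_eq (s := (Finset.univ : Finset (Fin n)))
    (n := r) (by simpa using hrn)
  obtain ⟨z, hz⟩ := (restrictPMF S (Enc fun _ => false)).support_nonempty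
  have hex : ∀ m, ∃ c ∈ (Enc m).support, (fun j : {i // i ∈ S} => c j.1) = z := fun m => by
    rw [eq_of_SD_eq_zero (hsec S hS.le _ m), restrictPMF, PMF.mem_support_map_iff] at hz
    exact hz
  choose c hc hcz using hex
  have hinj : Function.Injective fun (m : Word k) (j : {i // i ∉ S}) => c m j.1 := by
    intro m m' h
    have hcc : c m = c m' := by
      funext i
      by_cases hi : i ∈ S
      · exact congrFun ((hcz m).trans (hcz m').symm) ⟨i, hi⟩
      · exact congrFun h ⟨i, hi⟩
    have hm := hcorrect m _ (hc m)
    rw [hcc, hcorrect m' _ (hc m')] at hm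
    exact (Option.some.inj hm).symm
  have hcard := Fintype.card_le_of_injective _ hinj
  simp only [Fintype.card_fun, Fintype.card_bool, Fintype.card_fin, Fintype.card_subtype_compl,
    Fintype.card_coe, hS] at hcard
  exact (Nat.pow_le_pow_iff_right one_lt_two).mp hcard
end

section
/- Let (Enc,Dec) be a (k,n)-coding scheme that is strongly non-malleable with respect to the tampering family F_BIT^{[n],r,w} (with 1 ≤ w ≤ n and r ≤ n) with exact security 0. Then k ≤ n − r. (This is the rate upper bound 1 − ρ_r for perfectly secure strongly non-malleable codes.) -/
theorem PMF.eq_of_SD_le_zero {Z : Type*} [Fintype Z] {X Y : PMF Z} (h : SD X Y ≤ 0) :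
    X = Y := by
  ext z
  have hnn : ∀ z ∈ Finset.univ, 0 ≤ |(X z).toReal - (Y z).toReal| := fun _ _ => abs_nonneg _
  have hsum : ∑ z, |(X z).toReal - (Y z).toReal| = 0 := by
    unfold SD at h
    exact le_antisymm (by linarith) (Finset.sum_nonneg hnn)
  have hz := (Finset.sum_eq_zero_iff_of_nonneg hnn).1 hsum z (Finset.mem_univ z)
  exact (ENNReal.toReal_eq_toReal_iff' (X.apply_ne_top z) (Y.apply_ne_top z)).1
    (sub_eq_zero.1 (abs_eq_zero.1 hz))

/-- The tampering function flipping the bits in `Sw` exactly when the bits in `Sr` agree with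
those of `a`. -/
def flipOnMatch {n : ℕ} (Sr Sw : Finset (Fin n)) (a x : Word n) : Word n := fun i =>
  if i ∈ Sw ∧ ∀ j ∈ Sr, x j = a j then !x i else x i

theorem flipOnMatch_mem_FBIT {n : ℕ} (Sr Sw : Finset (Fin n)) (a : Word n) :
    flipOnMatch Sr Sw a ∈ FBIT n Sr.card Sw.card := by
  classical
  refine ⟨Sr, Sw, rfl, rfl, fun y _ b => if ∀ j, y j = a j.1 then !b else b, fun x i => ?_⟩
  by_cases hi : i ∈ Sw <;> simp [flipOnMatch, hi]

theorem flipOnMatch_ne_self_iff {n : ℕ} {Sr Sw : Finset (Fin n)} (hSw : Sw.Nonempty)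
    (a x : Word n) : flipOnMatch Sr Sw a x ≠ x ↔ ∀ j ∈ Sr, x j = a j := by
  rw [Function.ne_iff]
  constructor
  · rintro ⟨i, hi⟩
    by_contra hx
    exact hi (if_neg fun h => hx h.2)
  · intro hx
    obtain ⟨i, hi⟩ := hSw
    refine ⟨i, ?_⟩
    rw [flipOnMatch, if_pos ⟨hi, hx⟩]
    simp

/-- Under perfect strong non-malleability, the possibility that `f` changes an encoding of
a message does not depend on the message. -/
theorem StronglyNonMalleable.exists_ne_self {k n : ℕ} {Enc : Word k → PMF (Word n)}
    {Dec : Word n → Option (Word k)} {F : Set (Word n → Word n)}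
    (h : StronglyNonMalleable Enc Dec F 0) {f : Word n → Word n} (hf : f ∈ F)
    {m₀ : Word k} {c₀ : Word n} (hc₀ : c₀ ∈ (Enc m₀).support) (hne : f c₀ ≠ c₀) (m : Word k) :
    ∃ c ∈ (Enc m).support, f c ≠ c := by
  by_contra! hall
  have heq := PMF.eq_of_SD_le_zero (h f hf m₀ m)
  unfold StrongExp at heq
  obtain ⟨c, hc, hout⟩ := (PMF.mem_support_map_iff _ _ _).1
    (heq ▸ (PMF.mem_support_map_iff _ (Enc m₀) _).2 ⟨c₀, hc₀, rfl⟩)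
  rw [if_pos (hall c hc), if_neg hne] at hout
  cases hd : Dec (f c₀) <;> simp [hd] at hout

/-- A `(k,n)`-coding scheme that is strongly non-malleable with respect to
`F_BIT^{[n],r,w}` with exact security `0` satisfies `k ≤ n - r`. -/
theorem strongNM_perfect_rate_upper_bound
    (k n r w : ℕ) (hw1 : 1 ≤ w) (hwn : w ≤ n) (hrn : r ≤ n)
    (Enc : Word k → PMF (Word n)) (Dec : Word n → Option (Word k))
    (hcorrect : Correct Enc Dec)
    (hSNM : StronglyNonMalleable Enc Dec (FBIT n r w) 0) :
    k ≤ n - r := by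
  obtain ⟨Sr, -, hSr⟩ := Finset.exists_subset_card_eq
    (s := (Finset.univ : Finset (Fin n))) (n := r) (by simpa using hrn)
  obtain ⟨Sw, -, hSw⟩ := Finset.exists_subset_card_eq
    (s := (Finset.univ : Finset (Fin n))) (n := w) (by simpa using hwn)
  have hSw_ne : Sw.Nonempty := Finset.card_pos.1 (by omega)
  obtain ⟨a, ha⟩ := (Enc fun _ => false).support_nonempty
  have hf : flipOnMatch Sr Sw a ∈ FBIT n r w := hSr ▸ hSw ▸ flipOnMatch_mem_FBIT Sr Sw a
  have hcode : ∀ m, ∃ c ∈ (Enc m).support, ∀ j ∈ Sr, c j = a j := fun m => by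
    obtain ⟨c, hc, hne⟩ := hSNM.exists_ne_self hf ha
      ((flipOnMatch_ne_self_iff hSw_ne a a).2 fun _ _ => rfl) m
    exact ⟨c, hc, (flipOnMatch_ne_self_iff hSw_ne a c).1 hne⟩
  choose c hc hca using hcode
  have hinj : Function.Injective fun (m : Word k) (i : {i // i ∈ Srᶜ}) => c m i := by
    intro m m' hmm'
    have hcc : c m = c m' := by
      funext i
      by_cases hi : i ∈ Sr
      · rw [hca m i hi, hca m' i hi]
      · exact congrFun hmm' ⟨i, Finset.mem_compl.2 hi⟩
    have hdec := hcorrect m (c m) (hc m)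
    rw [hcc, hcorrect m' (c m') (hc m')] at hdec
    exact (Option.some.inj hdec).symm
  have hcard := Fintype.card_le_of_injective _ hinj
  simp only [Fintype.card_fun, Fintype.card_bool, Fintype.card_fin, Fintype.card_coe,
    Finset.card_compl, hSr] at hcard
  exact (Nat.pow_le_pow_iff_right (by norm_num)).1 hcard
end
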